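/- arXiv:1702.03546 — 16 statements merged into one kernel-verified Lean document; each statement's English description precedes it below -/
import Mathlib

section
/- For a finite simple graph G = (V,E) with m = |E| edges, the coefficient of the monomial xyz in the bipartition polynomial B(G;x,y,z) (viewed as a polynomial in x, y, z with integer coefficients) equals 2m, and G is bipartite if and only if half this coefficient equals the degree in z of the one-variable polynomial B(G;1,1,z) = ∑_{W⊆V} ∑_{F⊆∂W} z^{|F|}. Equivalently: G is bipartite if and only if the maximum of |∂W| over all vertex subsets W ⊆ V equals m. -/
open Finset

open scoped Classical

/-- The edge boundary `∂W` of a vertex subset `W`: the edges of `G` with exactly one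
endpoint in `W`. -/
noncomputable def edgeBoundary {V : Type*} [Fintype V] (G : SimpleGraph V) (W : Finset V) :
    Finset (Sym2 V) :=
  G.edgeFinset.filter fun e => ∃ u ∈ W, ∃ v ∉ W, e = s(u, v)

/-- `N_{(V,F)}(W)`: the vertices outside `W` incident with at least one edge of `F`. -/
noncomputable def extNbr {V : Type*} [Fintype V] (F : Finset (Sym2 V)) (W : Finset V) :
    Finset V :=
  Finset.univ.filter fun v => v ∉ W ∧ ∃ e ∈ F, v ∈ e

/-- The bipartition polynomial `B(G;x,y,z)` viewed as a polynomial in the three variables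
`x = X 0`, `y = X 1`, `z = X 2` with integer coefficients. -/
noncomputable def bipartitionMvPoly {V : Type*} [Fintype V] (G : SimpleGraph V) :
    MvPolynomial (Fin 3) ℤ :=
  ∑ W : Finset V, (MvPolynomial.X 0) ^ W.card *
    ∑ F ∈ (edgeBoundary G W).powerset,
      (MvPolynomial.X 1) ^ (extNbr F W).card * (MvPolynomial.X 2) ^ F.card

/-- The one-variable polynomial `B(G;1,1,z) = ∑_{W ⊆ V} ∑_{F ⊆ ∂W} z^{|F|}`. -/
noncomputable def bipartitionZPoly {V : Type*} [Fintype V] (G : SimpleGraph V) :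
    Polynomial ℤ :=
  ∑ W : Finset V, ∑ F ∈ (edgeBoundary G W).powerset, Polynomial.X ^ F.card

theorem bp_boundary_le {V : Type*} [Fintype V] (G : SimpleGraph V) (W : Finset V) :
    edgeBoundary G W ⊆ G.edgeFinset := Finset.filter_subset _ _

theorem bp_extNbr_card {V : Type*} [Fintype V] (G : SimpleGraph V) (W : Finset V)
    (F : Finset (Sym2 V)) (hF : F ⊆ edgeBoundary G W) (h1 : F.card = 1) :
    (extNbr F W).card = 1 := by
  obtain ⟨e, rfl⟩ := Finset.card_eq_one.1 h1
  have he : e ∈ edgeBoundary G W := hF (by simp)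
  obtain ⟨-, u, hu, v, hv, rfl⟩ := Finset.mem_filter.1 he
  rw [Finset.card_eq_one]
  refine ⟨v, ?_⟩
  ext w
  simp only [extNbr, Finset.mem_filter, Finset.mem_univ, true_and, Finset.mem_singleton,
    exists_eq_left, Sym2.mem_iff]
  constructor
  · rintro ⟨hw, rfl | rfl⟩
    · exact absurd hu hw
    · rfl
  · rintro rfl
    exact ⟨hv, Or.inr rfl⟩

theorem bp_coeff_term (a b c : ℕ) :
    ((MvPolynomial.X 0 : MvPolynomial (Fin 3) ℤ) ^ a *
      ((MvPolynomial.X 1) ^ b * (MvPolynomial.X 2) ^ c)).coeff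
        (Finsupp.single 0 1 + Finsupp.single 1 1 + Finsupp.single 2 1)
      = if a = 1 ∧ b = 1 ∧ c = 1 then 1 else 0 := by
  rw [MvPolynomial.X_pow_eq_monomial, MvPolynomial.X_pow_eq_monomial,
    MvPolynomial.X_pow_eq_monomial, MvPolynomial.monomial_mul, MvPolynomial.monomial_mul,
    MvPolynomial.coeff_monomial]
  simp only [mul_one]
  congr 1
  apply propext
  constructor
  · intro h
    have h0 := DFunLike.congr_fun h 0
    have h1 := DFunLike.congr_fun h 1
    have h2 := DFunLike.congr_fun h 2
    simp [Finsupp.single_apply] at h0 h1 h2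
    exact ⟨h0, h1, h2⟩
  · rintro ⟨rfl, rfl, rfl⟩
    rw [add_assoc]

theorem bp_boundary_single {V : Type*} [Fintype V] (G : SimpleGraph V) (v : V) :
    edgeBoundary G {v} = G.incidenceFinset v := by
  ext e
  induction e using Sym2.ind with
  | _ a b =>
    simp only [edgeBoundary, Finset.mem_filter, SimpleGraph.mem_edgeFinset,
      SimpleGraph.mem_edgeSet, Finset.mem_singleton, exists_eq_left,
      SimpleGraph.mem_incidenceFinset, SimpleGraph.incidenceSet, Set.mem_setOf_eq, Sym2.mem_iff,
      Sym2.eq_iff]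
    constructor
    · rintro ⟨h, w, hw, ⟨rfl, rfl⟩ | ⟨rfl, rfl⟩⟩
      · exact ⟨h, Or.inl rfl⟩
      · exact ⟨h, Or.inr rfl⟩
    · rintro ⟨h, rfl | rfl⟩
      · exact ⟨h, b, h.ne', Or.inl ⟨rfl, rfl⟩⟩
      · exact ⟨h, a, h.ne, Or.inr ⟨rfl, rfl⟩⟩

theorem bp_coeff {V : Type*} [Fintype V] (G : SimpleGraph V) :
    (bipartitionMvPoly G).coeff
        (Finsupp.single 0 1 + Finsupp.single 1 1 + Finsupp.single 2 1)
      = 2 * G.edgeFinset.card := by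
  have key : ∀ W : Finset V, ((MvPolynomial.X 0 : MvPolynomial (Fin 3) ℤ) ^ W.card *
      ∑ F ∈ (edgeBoundary G W).powerset,
        (MvPolynomial.X 1) ^ (extNbr F W).card * (MvPolynomial.X 2) ^ F.card).coeff
        (Finsupp.single 0 1 + Finsupp.single 1 1 + Finsupp.single 2 1)
      = if W.card = 1 then ((edgeBoundary G W).card : ℤ) else 0 := by
    intro W
    rw [Finset.mul_sum, MvPolynomial.coeff_sum]
    simp only [bp_coeff_term]
    split_ifs with hW
    · have : ∀ F ∈ (edgeBoundary G W).powerset,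
          (if W.card = 1 ∧ (extNbr F W).card = 1 ∧ F.card = 1 then (1 : ℤ) else 0)
            = if F.card = 1 then 1 else 0 := by
        intro F hF
        by_cases h : F.card = 1
        · simp [h, hW, bp_extNbr_card G W F (Finset.mem_powerset.1 hF) h]
        · simp [h]
      rw [Finset.sum_congr rfl this, Finset.sum_boole, ← Finset.powersetCard_eq_filter,
        Finset.card_powersetCard, Nat.choose_one_right]
    · simp [hW]
  rw [bipartitionMvPoly, MvPolynomial.coeff_sum, Finset.sum_congr rfl fun W _ => key W,
    ← Finset.sum_filter, ← Finset.powerset_univ, ← Finset.powersetCard_eq_filter,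
    Finset.powersetCard_one, Finset.sum_map]
  have := G.sum_degrees_eq_twice_card_edges
  rw [← Nat.cast_sum]
  simp only [Function.Embedding.coeFn_mk, bp_boundary_single,
    SimpleGraph.card_incidenceFinset_eq_degree]
  exact_mod_cast this

theorem bp_natDegree {V : Type*} [Fintype V] (G : SimpleGraph V) :
    (bipartitionZPoly G).natDegree
      = Finset.univ.sup fun W : Finset V => (edgeBoundary G W).card := by
  apply le_antisymm
  · refine Polynomial.natDegree_sum_le_of_forall_le _ _ fun W _ => ?_
    refine Polynomial.natDegree_sum_le_of_forall_le _ _ fun F hF => ?_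
    rw [Polynomial.natDegree_X_pow]
    exact (Finset.card_le_card (Finset.mem_powerset.1 hF)).trans
      (Finset.le_sup (f := fun W : Finset V => (edgeBoundary G W).card) (Finset.mem_univ W))
  · refine Finset.sup_le fun W _ => Polynomial.le_natDegree_of_ne_zero (ne_of_gt ?_)
    simp only [bipartitionZPoly, Polynomial.finsetSum_coeff, Polynomial.coeff_X_pow]
    have hn : ∀ (a b : ℕ), (0 : ℤ) ≤ if a = b then 1 else 0 := by
      intro a b; split_ifs <;> simp
    refine Finset.sum_pos' (fun W' _ => Finset.sum_nonneg fun F _ => hn _ _)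
      ⟨W, Finset.mem_univ _, ?_⟩
    refine Finset.sum_pos' (fun F _ => hn _ _)
      ⟨edgeBoundary G W, Finset.mem_powerset_self _, by simp⟩

theorem bp_colorable {V : Type*} [Fintype V] (G : SimpleGraph V) :
    G.Colorable 2 ↔
      (Finset.univ.sup fun W : Finset V => (edgeBoundary G W).card)
        = G.edgeFinset.card := by
  have hle : (Finset.univ.sup fun W : Finset V => (edgeBoundary G W).card)
      ≤ G.edgeFinset.card :=
    Finset.sup_le fun W _ => Finset.card_le_card (bp_boundary_le G W)
  constructor
  · rintro ⟨C⟩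
    refine le_antisymm hle ?_
    refine le_trans (Finset.card_le_card ?_)
      (Finset.le_sup (f := fun W : Finset V => (edgeBoundary G W).card)
        (Finset.mem_univ (Finset.univ.filter fun v => C v = 0)))
    intro e
    induction e using Sym2.ind with
    | _ a b =>
      intro h
      have hab : G.Adj a b := by simpa using h
      have hc := C.valid hab
      refine Finset.mem_filter.2 ⟨h, ?_⟩
      by_cases ha : C a = 0
      · exact ⟨a, by simpa using ha, b, by simpa using fun hb => hc (ha.trans hb.symm), rfl⟩
      · exact ⟨b, by simp; omega, a, by simpa using ha, Sym2.eq_swap⟩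
  · intro h
    obtain ⟨W, -, hW⟩ := Finset.exists_mem_eq_sup (Finset.univ : Finset (Finset V))
      Finset.univ_nonempty (fun W : Finset V => (edgeBoundary G W).card)
    have hE : edgeBoundary G W = G.edgeFinset :=
      Finset.eq_of_subset_of_card_le (bp_boundary_le G W) (by rw [← h, hW])
    refine ⟨SimpleGraph.Coloring.mk (fun v => if v ∈ W then 0 else 1) ?_⟩
    intro a b hab
    have hm : s(a, b) ∈ edgeBoundary G W := by rw [hE]; simpa using hab
    obtain ⟨-, u, hu, v, hv, he⟩ := Finset.mem_filter.1 hm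
    rcases Sym2.eq_iff.1 he with ⟨rfl, rfl⟩ | ⟨rfl, rfl⟩ <;> simp [hu, hv]

/-- The coefficient of the monomial `xyz` in `B(G;x,y,z)` equals `2m`; moreover `G` is
bipartite iff half this coefficient equals the degree in `z` of `B(G;1,1,z)`, equivalently
iff the maximum of `|∂W|` over all `W ⊆ V` equals `m`. -/
theorem bipartition_coeff_xyz_and_bipartite_criterion
    {V : Type*} [Fintype V] (G : SimpleGraph V) :
    (bipartitionMvPoly G).coeff
        (Finsupp.single 0 1 + Finsupp.single 1 1 + Finsupp.single 2 1)
      = 2 * G.edgeFinset.card ∧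
    (G.Colorable 2 ↔
      2 * ((bipartitionZPoly G).natDegree : ℤ)
        = (bipartitionMvPoly G).coeff
            (Finsupp.single 0 1 + Finsupp.single 1 1 + Finsupp.single 2 1)) ∧
    (G.Colorable 2 ↔
      (Finset.univ.sup fun W : Finset V => (edgeBoundary G W).card)
        = G.edgeFinset.card) := by
  refine ⟨bp_coeff G, ?_, bp_colorable G⟩
  rw [bp_coeff, bp_natDegree, bp_colorable]
  omega
end

section
/- For every finite simple graph G = (V,E) and all elements x, y, z of a commutative ring, the bipartition polynomial satisfies the product representation B(G;x,y,z) = ∑_{W⊆V} x^{|W|} ∏_{v ∈ N_G(W)} [ y·((1+z)^{|N_G(v) ∩ W|} − 1) + 1 ]. -/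
open Finset

open scoped Classical

/-- The bipartition polynomial
`B(G;x,y,z) = ∑_{W ⊆ V} x^{|W|} ∑_{F ⊆ ∂W} y^{|N_{(V,F)}(W)|} z^{|F|}`. -/
noncomputable def bipartitionPoly {V : Type*} [Fintype V] (G : SimpleGraph V)
    {R : Type*} [CommRing R] (x y z : R) : R :=
  ∑ W : Finset V, x ^ W.card *
    ∑ F ∈ (edgeBoundary G W).powerset, y ^ (extNbr F W).card * z ^ F.card

/-- The open neighborhood `N_G(W)` of a vertex set `W`: the vertices outside `W` adjacent
to some vertex of `W`. -/
noncomputable def openNbhd {V : Type*} [Fintype V] (G : SimpleGraph V) (W : Finset V) :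
    Finset V :=
  Finset.univ.filter fun v => v ∉ W ∧ ∃ w ∈ W, G.Adj w v

noncomputable def starE {V : Type*} [Fintype V] (G : SimpleGraph V) (W : Finset V) (v : V) :
    Finset (Sym2 V) :=
  (G.neighborFinset v ∩ W).image fun w => s(w, v)

theorem mem_starE {V : Type*} [Fintype V] (G : SimpleGraph V) (W : Finset V) (v : V)
    (e : Sym2 V) : e ∈ starE G W v ↔ ∃ w ∈ W, G.Adj v w ∧ e = s(w, v) := by
  simp only [starE, mem_image, mem_inter, SimpleGraph.mem_neighborFinset]
  constructor
  · rintro ⟨w, ⟨h1, h2⟩, rfl⟩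
    exact ⟨w, h2, h1, rfl⟩
  · rintro ⟨w, h2, h1, rfl⟩
    exact ⟨w, ⟨h1, h2⟩, rfl⟩

theorem card_starE {V : Type*} [Fintype V] (G : SimpleGraph V) (W : Finset V) (v : V) :
    (starE G W v).card = (G.neighborFinset v ∩ W).card := by
  apply card_image_of_injective
  intro a b h
  rcases Sym2.eq_iff.1 h with ⟨h, _⟩ | ⟨h1, h2⟩
  · exact h
  · exact h1.trans h2

theorem extNbr_union {V : Type*} [Fintype V] (A B : Finset (Sym2 V)) (W : Finset V) :
    extNbr (A ∪ B) W = extNbr A W ∪ extNbr B W := by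
  ext v
  simp only [extNbr, mem_filter, mem_univ, true_and, mem_union]
  constructor
  · rintro ⟨h, e, he | he, hv⟩
    · exact Or.inl ⟨h, e, he, hv⟩
    · exact Or.inr ⟨h, e, he, hv⟩
  · rintro (⟨h, e, he, hv⟩ | ⟨h, e, he, hv⟩)
    · exact ⟨h, e, Or.inl he, hv⟩
    · exact ⟨h, e, Or.inr he, hv⟩

theorem extNbr_sub {V : Type*} [Fintype V] (G : SimpleGraph V) (W S : Finset V)
    (A : Finset (Sym2 V)) (hA : A ⊆ S.biUnion (starE G W)) : extNbr A W ⊆ S := by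
  intro u hu
  simp only [extNbr, mem_filter, mem_univ, true_and] at hu
  obtain ⟨hu, e, he, hue⟩ := hu
  have := hA he
  rw [mem_biUnion] at this
  obtain ⟨v, hv, hev⟩ := this
  rw [mem_starE] at hev
  obtain ⟨w, hw, _, rfl⟩ := hev
  rcases Sym2.mem_iff.1 hue with rfl | rfl
  · exact absurd hw hu
  · exact hv

theorem extNbr_star {V : Type*} [Fintype V] (G : SimpleGraph V) (W : Finset V) (v : V)
    (hv : v ∉ W) (A : Finset (Sym2 V)) (hA : A ⊆ starE G W v) (hne : A ≠ ∅) :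
    extNbr A W = {v} := by
  apply subset_antisymm
  · apply extNbr_sub G
    simpa using hA
  · obtain ⟨e, he⟩ := nonempty_iff_ne_empty.2 hne
    obtain ⟨w, hw, _, rfl⟩ := (mem_starE G W v e).1 (hA he)
    simp only [singleton_subset_iff, extNbr, mem_filter, mem_univ, true_and]
    exact ⟨hv, _, he, Sym2.mem_mk_right _ _⟩

theorem sum_star {V : Type*} [Fintype V] (G : SimpleGraph V) (W : Finset V) (v : V)
    (hv : v ∉ W) {R : Type*} [CommRing R] (y z : R) :
    ∑ F ∈ (starE G W v).powerset, y ^ (extNbr F W).card * z ^ F.card =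
      y * ((1 + z) ^ (G.neighborFinset v ∩ W).card - 1) + 1 := by
  have key : ∑ F ∈ (starE G W v).powerset, z ^ F.card
      = (1 + z) ^ (G.neighborFinset v ∩ W).card := by
    have := Finset.sum_pow_mul_eq_add_pow z 1 (starE G W v)
    simp only [one_pow, mul_one] at this
    rw [this, card_starE, add_comm]
  have h0 : (∅ : Finset (Sym2 V)) ∈ (starE G W v).powerset := empty_mem_powerset _
  rw [← key, ← add_sum_erase _ _ h0, ← add_sum_erase _ _ h0]
  have : ∑ F ∈ (starE G W v).powerset.erase ∅, y ^ (extNbr F W).card * z ^ F.card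
      = ∑ F ∈ (starE G W v).powerset.erase ∅, y * z ^ F.card := by
    apply sum_congr rfl
    intro F hF
    rw [mem_erase, mem_powerset] at hF
    rw [extNbr_star G W v hv F hF.2 hF.1]
    simp
  rw [this, ← mul_sum]
  have : extNbr (∅ : Finset (Sym2 V)) W = ∅ := by simp [extNbr]
  rw [this]
  simp
  ring

theorem sum_powerset_disj {α R : Type*} [DecidableEq α] [CommRing R] (A B : Finset α) (h : Disjoint A B)
    (f : Finset α → R) : ∑ F ∈ (A ∪ B).powerset, f F =
      ∑ a ∈ A.powerset, ∑ b ∈ B.powerset, f (a ∪ b) := by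
  rw [← sum_product']
  symm
  have hd := Finset.disjoint_left.1 h
  refine sum_bij' (fun p _ => p.1 ∪ p.2) (fun F _ => (F ∩ A, F ∩ B)) ?_ ?_ ?_ ?_ ?_
  · rintro ⟨a, b⟩ hp
    simp only [mem_product, mem_powerset] at hp ⊢
    exact union_subset_union hp.1 hp.2
  · intro F hF
    simp
  · rintro ⟨a, b⟩ hp
    simp only [mem_product, mem_powerset] at hp
    obtain ⟨h1, h2⟩ := hp
    ext u
    · have := @h1 u
      have := @h2 u
      have := @hd u
      simp; tauto
    · have := @h1 u
      have := @h2 u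
      have := @hd u
      simp; tauto
  · intro F hF
    rw [mem_powerset] at hF
    simp only
    rw [← inter_union_distrib_left, inter_eq_left.2 hF]
  · intros; rfl

theorem sum_biUnion_star {V : Type*} [Fintype V] (G : SimpleGraph V) (W : Finset V)
    {R : Type*} [CommRing R] (y z : R) (S : Finset V) (hS : ∀ v ∈ S, v ∉ W) :
    ∑ F ∈ (S.biUnion (starE G W)).powerset, y ^ (extNbr F W).card * z ^ F.card =
      ∏ v ∈ S, (y * ((1 + z) ^ (G.neighborFinset v ∩ W).card - 1) + 1) := by
  induction S using Finset.induction_on with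
  | empty => simp [extNbr]
  | insert v S hv ih =>
    have hvW := hS v (mem_insert_self _ _)
    have hdis : Disjoint (starE G W v) (S.biUnion (starE G W)) := by
      rw [Finset.disjoint_left]
      intro e he he2
      obtain ⟨u, hu, hue⟩ := mem_biUnion.1 he2
      obtain ⟨w, hw, _, rfl⟩ := (mem_starE G W v e).1 he
      obtain ⟨w', hw', _, h⟩ := (mem_starE G W u _).1 hue
      rcases Sym2.eq_iff.1 h with ⟨_, rfl⟩ | ⟨_, rfl⟩
      · exact hv hu
      · exact hvW hw'
    rw [prod_insert hv, ← ih fun u hu => hS u (mem_insert_of_mem hu), ← sum_star G W v hvW,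
      biUnion_insert, sum_powerset_disj _ _ hdis, sum_mul_sum]
    apply sum_congr rfl
    intro a ha
    apply sum_congr rfl
    intro b hb
    rw [mem_powerset] at ha hb
    have h1 : extNbr a W ⊆ {v} := extNbr_sub G W {v} a (by simpa using ha)
    have h2 := extNbr_sub G W S b hb
    have h3 : Disjoint (extNbr a W) (extNbr b W) :=
      Disjoint.mono h1 h2 (by simpa using hv)
    rw [extNbr_union, card_union_of_disjoint h3,
      card_union_of_disjoint (Disjoint.mono ha hb hdis)]
    ring

theorem edgeBoundary_eq {V : Type*} [Fintype V] (G : SimpleGraph V) (W : Finset V) :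
    edgeBoundary G W = (openNbhd G W).biUnion (starE G W) := by
  ext e
  simp only [edgeBoundary, openNbhd, mem_biUnion, mem_filter, mem_univ, true_and, mem_starE,
    SimpleGraph.mem_edgeFinset]
  constructor
  · rintro ⟨he, u, hu, v, hv, rfl⟩
    have he : G.Adj u v := he
    exact ⟨v, ⟨hv, u, hu, he⟩, u, hu, he.symm, rfl⟩
  · rintro ⟨v, ⟨hv, -⟩, u, hu, he, rfl⟩
    exact ⟨he.symm, u, hu, v, hv, rfl⟩

/-- Product representation of the bipartition polynomial:
`B(G;x,y,z) = ∑_{W⊆V} x^{|W|} ∏_{v ∈ N_G(W)} [y((1+z)^{|N_G(v) ∩ W|} − 1) + 1]`. -/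
theorem bipartitionPoly_product_representation {V : Type*} [Fintype V] (G : SimpleGraph V)
    {R : Type*} [CommRing R] (x y z : R) :
    bipartitionPoly G x y z =
      ∑ W : Finset V, x ^ W.card *
        ∏ v ∈ openNbhd G W,
          (y * ((1 + z) ^ (G.neighborFinset v ∩ W).card - 1) + 1) := by
  unfold bipartitionPoly
  apply sum_congr rfl
  intro W _
  rw [edgeBoundary_eq, sum_biUnion_star]
  intro v hv
  simp only [openNbhd, mem_filter] at hv
  exact hv.2.1
end

section
/- For every finite simple graph G with k(G) connected components, the evaluation of the bipartition polynomial at x = 1, y = 1, z = −1 satisfies B(G;1,1,−1) = 2^{k(G)}. -/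
open Finset

open scoped Classical

/-- The number of connected components. -/
noncomputable def numComponents {V : Type*} [Fintype V] (G : SimpleGraph V) : ℕ :=
  Fintype.card G.ConnectedComponent

theorem edgeBoundary_eq_empty_iff_aux {V : Type*} [Fintype V] (G : SimpleGraph V) (W : Finset V) :
    edgeBoundary G W = ∅ ↔ ∀ u v, G.Adj u v → u ∈ W → v ∈ W := by
  unfold edgeBoundary
  rw [Finset.filter_eq_empty_iff]
  constructor
  · intro h u v huv hu
    by_contra hv
    exact h (x := s(u, v)) (by simpa using huv) ⟨u, hu, v, hv, rfl⟩
  · rintro h e he ⟨u, hu, v, hv, rfl⟩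
    exact hv (h u v (by simpa using he) hu)

/-- `B(G;1,1,−1) = 2^{k(G)}` where `k(G)` is the number of connected components of `G`. -/
theorem bipartitionPoly_one_one_negOne {V : Type*} [Fintype V] (G : SimpleGraph V) :
    bipartitionPoly G (1 : ℤ) 1 (-1) = 2 ^ numComponents G := by
  unfold bipartitionPoly numComponents
  simp only [one_pow, one_mul, Finset.sum_powerset_neg_one_pow_card]
  rw [Finset.sum_boole, ← Nat.cast_ofNat, ← Nat.cast_pow,
    ← Fintype.card_finset, ← Finset.card_univ]
  congr 1
  symm
  refine Finset.card_bij
    (fun S _ => Finset.univ.filter fun v => G.connectedComponentMk v ∈ S) ?_ ?_ ?_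
  · intro S _
    simp only [Finset.mem_filter, Finset.mem_univ, true_and, edgeBoundary_eq_empty_iff_aux]
    intro u v huv hu
    rwa [← SimpleGraph.ConnectedComponent.connectedComponentMk_eq_of_adj huv]
  · intro S _ T _ h
    ext c
    induction c using SimpleGraph.ConnectedComponent.ind with
    | h v => simpa using congrArg (v ∈ ·) h
  · intro W hW
    simp only [Finset.mem_filter, Finset.mem_univ, true_and, edgeBoundary_eq_empty_iff_aux] at hW
    refine ⟨W.image G.connectedComponentMk, Finset.mem_univ _, ?_⟩
    ext v
    simp only [Finset.mem_filter, Finset.mem_univ, true_and, Finset.mem_image]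
    constructor
    · rintro ⟨u, hu, huv⟩
      obtain ⟨p⟩ := SimpleGraph.ConnectedComponent.exact huv
      clear huv
      induction p with
      | nil => exact hu
      | cons h _ ih => exact ih (hW _ _ h hu)
    · intro hv
      exact ⟨v, hv, rfl⟩
end

section
/- Let G be a finite simple graph whose connected components are G_1, …, G_k, where G_i has order k_i. Then for every element x of a commutative ring, B(G;x,1,−1) = ∏_{i=1}^{k} (1 + x^{k_i}). -/
open Finset

open scoped Classical

theorem bp_inner {α R : Type*} [CommRing R] (s : Finset α) :
    ∑ F ∈ s.powerset, (-1 : R) ^ F.card = if s = ∅ then 1 else 0 := by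
  have h := Finset.sum_pow_mul_eq_add_pow (-1 : R) 1 s
  simp only [one_pow, mul_one, neg_add_cancel] at h
  rw [h]
  split_ifs with hs
  · simp [hs]
  · exact zero_pow (by simpa using hs)

theorem bp_closed {V : Type*} [Fintype V] (G : SimpleGraph V) (W : Finset V)
    (h : edgeBoundary G W = ∅) {u v : V} (huv : G.Reachable u v) (hu : u ∈ W) : v ∈ W := by
  obtain ⟨p⟩ := huv
  induction p with
  | nil => exact hu
  | @cons a b c hab p ih =>
    apply ih
    by_contra hb
    have : s(a, b) ∈ edgeBoundary G W := by
      simp only [edgeBoundary, Finset.mem_filter, SimpleGraph.mem_edgeFinset,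
        SimpleGraph.mem_edgeSet]
      exact ⟨hab, a, hu, b, hb, rfl⟩
    rw [h] at this
    simp at this

theorem bp_boundary {V : Type*} [Fintype V] (G : SimpleGraph V)
    (t : Finset G.ConnectedComponent) :
    edgeBoundary G (Finset.univ.filter fun v => G.connectedComponentMk v ∈ t) = ∅ := by
  ext e
  simp only [edgeBoundary, Finset.mem_filter, SimpleGraph.mem_edgeFinset, Finset.mem_univ,
    true_and, Finset.notMem_empty, iff_false]
  rintro ⟨he, u, hu, v, hv, rfl⟩
  have hadj : G.Adj u v := he
  exact hv (by rwa [← SimpleGraph.ConnectedComponent.sound hadj.reachable])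

theorem bp_card {V : Type*} [Fintype V] (G : SimpleGraph V)
    (t : Finset G.ConnectedComponent) :
    (Finset.univ.filter fun v => G.connectedComponentMk v ∈ t).card =
      ∑ c ∈ t, c.supp.toFinset.card := by
  rw [Finset.card_eq_sum_card_fiberwise (f := G.connectedComponentMk) (t := t)
    (by intro v hv; simpa using hv)]
  refine Finset.sum_congr rfl fun c hc => ?_
  congr 1
  ext v
  simp only [Finset.mem_filter, Finset.mem_univ, true_and, Set.mem_toFinset,
    SimpleGraph.ConnectedComponent.mem_supp_iff]
  exact ⟨fun h => h.2, fun h => ⟨h ▸ hc, h⟩⟩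

/-- If the connected components of `G` have orders `k_1, …, k_k`, then
`B(G;x,1,−1) = ∏_{i=1}^{k} (1 + x^{k_i})`. -/
theorem bipartitionPoly_x_one_negOne {V : Type*} [Fintype V] (G : SimpleGraph V)
    {R : Type*} [CommRing R] (x : R) :
    bipartitionPoly G x (1 : R) (-1) =
      ∏ c : G.ConnectedComponent, (1 + x ^ c.supp.toFinset.card) := by
  unfold bipartitionPoly
  simp only [one_pow, one_mul, bp_inner, mul_ite, mul_one, mul_zero]
  rw [← Finset.sum_filter, Finset.prod_one_add]
  symm
  refine Finset.sum_bij
    (fun t _ => Finset.univ.filter fun v => G.connectedComponentMk v ∈ t) ?_ ?_ ?_ ?_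
  · intro t _
    simp only [Finset.mem_filter, Finset.mem_univ, true_and]
    exact bp_boundary G t
  · intro t _ t' _ h
    ext c
    induction c using SimpleGraph.ConnectedComponent.ind with
    | _ v => simpa using Finset.ext_iff.1 h v
  · intro W hW
    have hW' : edgeBoundary G W = ∅ := (Finset.mem_filter.1 hW).2
    refine ⟨W.image G.connectedComponentMk, by simp, ?_⟩
    ext v
    simp only [Finset.mem_filter, Finset.mem_univ, true_and, Finset.mem_image]
    constructor
    · rintro ⟨u, hu, huv⟩
      exact bp_closed G W hW' (SimpleGraph.ConnectedComponent.exact huv) hu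
    · intro hv
      exact ⟨v, hv, rfl⟩
  · intro t _
    rw [bp_card, Finset.prod_pow_eq_pow_sum]
end

section
/- For every finite simple graph G = (V,E) and all elements x, y, z of a commutative ring, the bipartition polynomial satisfies the bipartite representation B(G;x,y,z) = ∑_{F⊆E, (V,F) bipartite} z^{|F|} (1+x)^{iso(V,F)} ∏_{(S∪T,A) ∈ cp(V,F)} (x^{|S|} y^{|T|} + x^{|T|} y^{|S|}), where the product ranges over the proper components of the spanning subgraph (V,F), each with its (unique up to swap) bipartition (S,T). -/
open Finset

open scoped Classical

/-- The number of isolated vertices of the spanning subgraph `(V,F)`. -/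
noncomputable def isoCount {V : Type*} [Fintype V] (F : Finset (Sym2 V)) : ℕ :=
  (Finset.univ.filter fun v : V => ∀ e ∈ F, v ∉ e).card

/-- The proper (i.e. containing at least one edge) connected components of `H`. -/
noncomputable def properComps {V : Type*} [Fintype V] (H : SimpleGraph V) :
    Finset H.ConnectedComponent :=
  Finset.univ.filter fun c => ∃ u v, H.Adj u v ∧ u ∈ c.supp

/-- The factor `x^{|S|} y^{|T|} + x^{|T|} y^{|S|}` attached to a bipartite connected
component `c` with bipartition `(S,T)`; defined via choice (it is well defined, since for a
proper bipartite component the bipartition is unique up to swapping, and the expression is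
symmetric under swapping). -/
noncomputable def compFactor {V : Type*} [Fintype V] (H : SimpleGraph V)
    (c : H.ConnectedComponent) {R : Type*} [CommRing R] (x y : R) : R :=
  if h : ∃ p : Finset V × Finset V, Disjoint p.1 p.2 ∧ (↑p.1 ∪ ↑p.2 : Set V) = c.supp ∧
      ∀ u v, H.Adj u v → u ∈ c.supp → ((u ∈ p.1 ∧ v ∈ p.2) ∨ (u ∈ p.2 ∧ v ∈ p.1))
  then x ^ h.choose.1.card * y ^ h.choose.2.card + x ^ h.choose.2.card * y ^ h.choose.1.card
  else 0

lemma bp_reach {V : Type*} {H : SimpleGraph V} {P : V → Prop}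
    (hP : ∀ a b, H.Adj a b → P a → P b) {u v : V} (h : H.Reachable u v) (hu : P u) : P v := by
  obtain ⟨p⟩ := h
  induction p with
  | nil => exact hu
  | cons hadj p ih => exact ih (hP _ _ hadj hu)

noncomputable def bpW {V : Type*} (H : SimpleGraph V) {R : Type*} [CommRing R] (x y : R)
    (v : V) (b : Bool) : R :=
  if b = true then x else if ∃ u, H.Adj v u then y else 1

lemma bp_prodST {V : Type*} [Fintype V] (H : SimpleGraph V) {R : Type*} [CommRing R] (x y : R)
    (c : H.ConnectedComponent) (hn : ∀ v, H.connectedComponentMk v = c → ∃ u, H.Adj v u)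
    (S T : Finset V) (hd : Disjoint S T) (hST : (↑S ∪ ↑T : Set V) = c.supp)
    (f : V → Bool) (hS : ∀ v ∈ S, f v = true) (hT : ∀ v ∈ T, f v = false) :
    ∏ v ∈ univ.filter (fun v => H.connectedComponentMk v = c), bpW H x y v (f v)
      = x ^ S.card * y ^ T.card := by
  have hmem : ∀ v, (v ∈ S ∨ v ∈ T) ↔ H.connectedComponentMk v = c := by
    intro v
    have := Set.ext_iff.1 hST v
    simpa using this
  have : univ.filter (fun v => H.connectedComponentMk v = c) = S ∪ T := by
    ext v; simp [hmem]
  rw [this, Finset.prod_union hd]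
  congr 1
  · rw [← Finset.prod_const]
    exact Finset.prod_congr rfl fun v hv => by simp [bpW, hS v hv]
  · rw [← Finset.prod_const]
    refine Finset.prod_congr rfl fun v hv => ?_
    have := hn v ((hmem v).1 (Or.inr hv))
    simp [bpW, hT v hv, this]

lemma bp_proper_adj {V : Type*} [Fintype V] (H : SimpleGraph V) (c : H.ConnectedComponent)
    (hc : c ∈ properComps H) (v : V) (hv : H.connectedComponentMk v = c) : ∃ u, H.Adj v u := by
  simp only [properComps, mem_filter, mem_univ, true_and] at hc
  obtain ⟨a, b, hab, ha⟩ := hc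
  rw [SimpleGraph.ConnectedComponent.mem_supp_iff, ← hv, SimpleGraph.ConnectedComponent.eq] at ha
  exact bp_reach (P := fun v => ∃ u, H.Adj v u) (fun a b h _ => ⟨a, h.symm⟩) ha ⟨b, hab⟩

lemma bp_proper {V : Type*} [Fintype V] (H : SimpleGraph V) {R : Type*} [CommRing R] (x y : R)
    (χ : V → Bool) (hχ : ∀ u v, H.Adj u v → χ u ≠ χ v) (c : H.ConnectedComponent)
    (hc : c ∈ properComps H) :
    ∑ b : Bool, ∏ v ∈ univ.filter (fun v => H.connectedComponentMk v = c),
      bpW H x y v (xor (χ v) b) = compFactor H c x y := by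
  have h : ∃ p : Finset V × Finset V, Disjoint p.1 p.2 ∧ (↑p.1 ∪ ↑p.2 : Set V) = c.supp ∧
      ∀ u v, H.Adj u v → u ∈ c.supp → ((u ∈ p.1 ∧ v ∈ p.2) ∨ (u ∈ p.2 ∧ v ∈ p.1)) := by
    refine ⟨(univ.filter fun v => v ∈ c.supp ∧ χ v = true,
      univ.filter fun v => v ∈ c.supp ∧ χ v = false), ?_, ?_, ?_⟩
    · rw [Finset.disjoint_left]; intro a; simp; grind
    · ext v; simp; grind
    · intro u v huv hu
      have hv : v ∈ c.supp := by
        rw [SimpleGraph.ConnectedComponent.mem_supp_iff] at hu ⊢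
        rw [← hu, SimpleGraph.ConnectedComponent.eq]
        exact huv.symm.reachable
      have := hχ u v huv
      simp only [mem_filter, mem_univ, true_and, hu, hv]
      cases h1 : χ u <;> cases h2 : χ v <;> simp_all
  have hn := bp_proper_adj H c hc
  rw [compFactor, dif_pos h]
  obtain ⟨hd, hST, hadj⟩ := h.choose_spec
  generalize h.choose.1 = S at *
  generalize h.choose.2 = T at *
  have hmem : ∀ v, (v ∈ S ∨ v ∈ T) ↔ H.connectedComponentMk v = c := by
    intro v
    have := Set.ext_iff.1 hST v
    simpa using this
  obtain ⟨u, rfl⟩ := c.exists_rep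
  have hdis := Finset.disjoint_left.1 hd
  obtain ⟨b, hb⟩ : ∃ b, (u ∈ S ↔ χ u = b) := by
    by_cases h : u ∈ S
    · exact ⟨χ u, by simp [h]⟩
    · exact ⟨!χ u, by simp [h]⟩
  have key : ∀ v, H.connectedComponentMk v = H.connectedComponentMk u → (v ∈ S ↔ χ v = b) := by
    intro v hv
    refine (bp_reach (P := fun v => H.connectedComponentMk v = H.connectedComponentMk u ∧
      (v ∈ S ↔ χ v = b)) ?_ (SimpleGraph.ConnectedComponent.eq.1 hv.symm) ⟨rfl, hb⟩).2
    rintro p q hpq ⟨hp, hp2⟩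
    refine ⟨by rw [← hp, SimpleGraph.ConnectedComponent.eq]; exact hpq.symm.reachable, ?_⟩
    have h1 := hadj p q hpq hp
    have h2 := hχ p q hpq
    have h3 := @hdis p
    have h4 := @hdis q
    cases h5 : χ p <;> cases h6 : χ q <;> cases b <;> simp_all <;> tauto
  have kS : ∀ v ∈ S, χ v = b := fun v hv => (key v ((hmem v).1 (Or.inl hv))).1 hv
  have kT : ∀ v ∈ T, χ v = !b := fun v hv => by
    have h1 := key v ((hmem v).1 (Or.inr hv))
    have h2 : v ∉ S := fun h => hdis h hv
    cases h5 : χ v <;> cases b <;> simp_all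
  have hd' := hd.symm
  have hST' := hST
  rw [Set.union_comm] at hST'
  have A := bp_prodST H x y _ hn S T hd hST (fun v => xor (χ v) (!b))
    (fun v hv => by simp [kS v hv]) (fun v hv => by simp [kT v hv])
  have B := bp_prodST H x y _ hn T S hd' hST' (fun v => xor (χ v) b)
    (fun v hv => by simp [kT v hv]) (fun v hv => by simp [kS v hv])
  rw [Fintype.sum_bool]
  cases b
  · simp only [Bool.not_false] at A
    exact congrArg₂ (· + ·) A B
  · simp only [Bool.not_true] at A
    rw [add_comm]
    exact congrArg₂ (· + ·) A B

lemma bp_sum {V : Type*} [Fintype V] (H : SimpleGraph V) {R : Type*} [CommRing R] (x y : R)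
    (χ : V → Bool) (hχ : ∀ u v, H.Adj u v → χ u ≠ χ v) :
    ∑ W ∈ univ.filter (fun W : Finset V => ∀ u v, H.Adj u v → (u ∈ W ↔ v ∉ W)),
      ∏ v, bpW H x y v (decide (v ∈ W)) =
    ∏ c : H.ConnectedComponent, ∑ b : Bool,
      ∏ v ∈ univ.filter (fun v => H.connectedComponentMk v = c), bpW H x y v (xor (χ v) b) := by
  rw [Finset.prod_univ_sum]
  have hf : ∀ (W : Finset V), (∀ u v, H.Adj u v → (u ∈ W ↔ v ∉ W)) → ∀ u v, H.Reachable u v →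
      xor (χ u) (decide (u ∈ W)) = xor (χ v) (decide (v ∈ W)) := by
    intro W hW u v huv
    refine bp_reach (P := fun v => xor (χ u) (decide (u ∈ W)) = xor (χ v) (decide (v ∈ W)))
      ?_ huv rfl
    intro p q hpq hp
    rw [hp]
    have h1 := hχ p q hpq
    have h2 := hW p q hpq
    by_cases h : q ∈ W <;> cases h3 : χ p <;> cases h4 : χ q <;> simp_all
  symm
  refine Finset.sum_bij (fun ε _ => univ.filter fun v =>
    xor (χ v) (ε (H.connectedComponentMk v)) = true) ?_ ?_ ?_ ?_
  · intro ε _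
    simp only [mem_filter, mem_univ, true_and]
    intro u v huv
    have h1 := hχ u v huv
    have h2 : H.connectedComponentMk u = H.connectedComponentMk v :=
      SimpleGraph.ConnectedComponent.eq.2 huv.reachable
    rw [h2]
    cases h3 : χ u <;> cases h4 : χ v <;> simp_all
  · intro ε _ ε' _ h
    funext c
    obtain ⟨u, rfl⟩ := c.exists_rep
    have := Finset.ext_iff.1 h u
    simp only [mem_filter, mem_univ, true_and] at this
    change ε (H.connectedComponentMk u) = ε' (H.connectedComponentMk u)
    cases h3 : χ u <;> cases h4 : ε (H.connectedComponentMk u) <;>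
      cases h5 : ε' (H.connectedComponentMk u) <;> simp_all
  · intro W hW
    simp only [mem_filter, mem_univ, true_and] at hW
    refine ⟨fun c => xor (χ c.out) (decide (c.out ∈ W)), Fintype.mem_piFinset.2 fun _ => mem_univ _, ?_⟩
    ext v
    simp only [mem_filter, mem_univ, true_and]
    have h1 : H.Reachable (H.connectedComponentMk v).out v :=
      SimpleGraph.ConnectedComponent.eq.1 (Quot.out_eq (H.connectedComponentMk v))
    rw [hf W hW _ _ h1]
    simp
  · intro ε _
    rw [← Finset.prod_fiberwise (s := univ) (g := H.connectedComponentMk)]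
    refine Finset.prod_congr rfl fun c _ => Finset.prod_congr rfl fun v hv => ?_
    simp only [mem_filter, mem_univ, true_and] at hv
    subst hv
    congr 1
    rw [Bool.eq_iff_iff]
    simp only [mem_filter, mem_univ, true_and, decide_eq_true_eq]

lemma bp_notproper {V : Type*} [Fintype V] (H : SimpleGraph V) {R : Type*} [CommRing R] (x y : R)
    (χ : V → Bool) (u : V) (hc : H.connectedComponentMk u ∉ properComps H) :
    ∑ b : Bool, ∏ v ∈ univ.filter (fun v => H.connectedComponentMk v = H.connectedComponentMk u),
      bpW H x y v (xor (χ v) b) = 1 + x := by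
  have hc' : ¬ ∃ v, H.Adj u v := by
    rintro ⟨v, hv⟩
    exact hc (by simp only [properComps, mem_filter, mem_univ, true_and]; exact ⟨u, v, hv, rfl⟩)
  have : univ.filter (fun v => H.connectedComponentMk v = H.connectedComponentMk u) = {u} := by
    ext v
    simp only [mem_filter, mem_univ, true_and, mem_singleton]
    constructor
    · intro h
      exact bp_reach (P := fun v => v = u)
        (fun a b hab ha => absurd ⟨b, ha ▸ hab⟩ hc')
        (SimpleGraph.ConnectedComponent.eq.1 h.symm) rfl
    · rintro rfl; rfl
  rw [this]
  simp only [prod_singleton, Fintype.sum_bool]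
  cases χ u <;> simp [bpW, hc', add_comm]

lemma bp_iso {V : Type*} [Fintype V] (H : SimpleGraph V) :
    (univ.filter fun c => c ∉ properComps H).card
      = (univ.filter fun v : V => ¬ ∃ u, H.Adj v u).card := by
  symm
  refine Finset.card_bij (fun v _ => H.connectedComponentMk v) ?_ ?_ ?_
  · intro v hv
    simp only [mem_filter, mem_univ, true_and] at hv ⊢
    intro h
    exact hv (bp_proper_adj H _ h v rfl)
  · intro v hv w _ h
    simp only [mem_filter, mem_univ, true_and] at hv
    exact (bp_reach (P := fun w => w = v)
        (fun a b hab ha => absurd ⟨b, ha ▸ hab⟩ hv)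
        (SimpleGraph.ConnectedComponent.eq.1 h) rfl).symm
  · intro c hc
    obtain ⟨u, hu⟩ := c.exists_rep
    have hu' : H.connectedComponentMk u = c := hu
    subst hu'
    refine ⟨u, ?_, rfl⟩
    simp only [mem_filter, mem_univ, true_and] at ⊢
    rintro ⟨v, hv⟩
    exact (mem_filter.1 hc).2 (by simp only [properComps, mem_filter, mem_univ, true_and]; exact ⟨u, v, hv, rfl⟩)

lemma bp_main {V : Type*} [Fintype V] (H : SimpleGraph V) {R : Type*} [CommRing R] (x y : R)
    (χ : V → Bool) (hχ : ∀ u v, H.Adj u v → χ u ≠ χ v) (n : ℕ)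
    (hn : n = (univ.filter fun v : V => ¬ ∃ u, H.Adj v u).card) :
    ∑ W ∈ univ.filter (fun W : Finset V => ∀ u v, H.Adj u v → (u ∈ W ↔ v ∉ W)),
      ∏ v, bpW H x y v (decide (v ∈ W)) =
    (1 + x) ^ n *
      ∏ c ∈ properComps H, compFactor H c x y := by
  rw [bp_sum H x y χ hχ, hn, ← bp_iso, ← Finset.prod_const,
    ← Finset.prod_filter_mul_prod_filter_not univ (fun c => c ∉ properComps H)]
  congr 1
  · refine Finset.prod_congr rfl fun c hc => ?_
    obtain ⟨u, rfl⟩ := c.exists_rep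
    exact bp_notproper H x y χ u (mem_filter.1 hc).2
  · refine Finset.prod_congr (by ext; simp) fun c hc => ?_
    exact bp_proper H x y χ hχ c hc

lemma bp_weight {V : Type*} [Fintype V] (H : SimpleGraph V) {R : Type*} [CommRing R] (x y : R)
    (W N : Finset V) (hN : ∀ v, v ∈ N ↔ v ∉ W ∧ ∃ u, H.Adj v u) :
    ∏ v, bpW H x y v (decide (v ∈ W)) = x ^ W.card * y ^ N.card := by
  have h : ∀ v, bpW H x y v (decide (v ∈ W)) =
      (if v ∈ W then x else 1) * (if v ∈ N then y else 1) := by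
    intro v
    by_cases h1 : v ∈ W <;> by_cases h2 : ∃ u, H.Adj v u <;> simp [bpW, h1, h2, hN]
  rw [Finset.prod_congr rfl fun v _ => h v, Finset.prod_mul_distrib, ← Finset.prod_filter,
    ← Finset.prod_filter]
  simp

lemma bp_inc {V : Type*} [Fintype V] (G : SimpleGraph V) (F : Finset (Sym2 V))
    (hF : F ⊆ G.edgeFinset) (v : V) :
    (∃ u, (SimpleGraph.fromEdgeSet (↑F : Set (Sym2 V))).Adj v u) ↔ ∃ e ∈ F, v ∈ e := by
  constructor
  · rintro ⟨u, hu⟩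
    rw [SimpleGraph.fromEdgeSet_adj] at hu
    exact ⟨s(v, u), hu.1, by simp⟩
  · rintro ⟨e, he, hv⟩
    obtain ⟨u, rfl⟩ := Sym2.mem_iff_exists.1 hv
    have := hF he
    rw [SimpleGraph.mem_edgeFinset, SimpleGraph.mem_edgeSet] at this
    exact ⟨u, by rw [SimpleGraph.fromEdgeSet_adj]; exact ⟨he, this.ne⟩⟩

lemma bp_bdry {V : Type*} [Fintype V] (G : SimpleGraph V) (F : Finset (Sym2 V))
    (hF : F ⊆ G.edgeFinset) (W : Finset V) :
    F ⊆ edgeBoundary G W ↔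
      ∀ u v, (SimpleGraph.fromEdgeSet (↑F : Set (Sym2 V))).Adj u v → (u ∈ W ↔ v ∉ W) := by
  constructor
  · intro h u v huv
    rw [SimpleGraph.fromEdgeSet_adj] at huv
    have := h huv.1
    simp only [edgeBoundary, mem_filter] at this
    obtain ⟨_, a, ha, b, hb, hab⟩ := this
    rw [Sym2.eq_iff] at hab
    rcases hab with ⟨rfl, rfl⟩ | ⟨rfl, rfl⟩ <;> simp [ha, hb]
  · intro h e he
    have hG := hF he
    simp only [edgeBoundary, mem_filter]
    refine ⟨hG, ?_⟩
    induction e using Sym2.ind with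
    | _ u v =>
      rw [SimpleGraph.mem_edgeFinset, SimpleGraph.mem_edgeSet] at hG
      have := h u v (by rw [SimpleGraph.fromEdgeSet_adj]; exact ⟨he, hG.ne⟩)
      by_cases hu : u ∈ W
      · exact ⟨u, hu, v, this.1 hu, rfl⟩
      · exact ⟨v, by tauto, u, hu, Sym2.eq_swap⟩

/-- Bipartite representation of the bipartition polynomial:
`B(G;x,y,z) = ∑_{F⊆E, (V,F) bipartite} z^{|F|} (1+x)^{iso(V,F)}
  ∏_{(S∪T,A) ∈ cp(V,F)} (x^{|S|} y^{|T|} + x^{|T|} y^{|S|})`. -/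
theorem bipartitionPoly_bipartite_representation {V : Type*} [Fintype V]
    (G : SimpleGraph V) {R : Type*} [CommRing R] (x y z : R) :
    bipartitionPoly G x y z =
      ∑ F ∈ G.edgeFinset.powerset.filter
          (fun F : Finset (Sym2 V) =>
            (SimpleGraph.fromEdgeSet (↑F : Set (Sym2 V))).Colorable 2),
        z ^ F.card * (1 + x) ^ isoCount F *
          ∏ c ∈ properComps (SimpleGraph.fromEdgeSet (↑F : Set (Sym2 V))),
            compFactor (SimpleGraph.fromEdgeSet (↑F : Set (Sym2 V))) c x y := by
  unfold bipartitionPoly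
  simp only [Finset.mul_sum]
  rw [Finset.sum_comm' (t' := G.edgeFinset.powerset)
    (s' := fun F => univ.filter fun W => F ⊆ edgeBoundary G W)
    (by
      intro W F
      simp only [mem_univ, true_and, mem_powerset, mem_filter]
      exact ⟨fun h => ⟨h, h.trans (Finset.filter_subset _ _)⟩, fun h => h.1⟩)]
  rw [Finset.sum_filter]
  refine Finset.sum_congr rfl fun F hF => ?_
  rw [mem_powerset] at hF
  simp only [bp_bdry G F hF]
  split_ifs with hcol
  · obtain ⟨C⟩ := hcol
    have hm := bp_main (SimpleGraph.fromEdgeSet (↑F : Set (Sym2 V))) x y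
      (fun v => decide (C v = 0)) (by
        intro u v huv
        have := C.valid huv
        simp only [ne_eq, decide_eq_decide]
        generalize C u = a at *
        generalize C v = b at *
        revert a b; decide) (isoCount F) (by
        rw [isoCount]
        congr 1
        ext v
        simp only [mem_filter, mem_univ, true_and, bp_inc G F hF, not_exists, not_and])
    rw [mul_assoc, ← hm, Finset.mul_sum]
    refine Finset.sum_congr (by ext W; simp only [mem_filter]) fun W _ => ?_
    rw [bp_weight _ x y W (extNbr F W) (by
      intro v
      simp only [extNbr, mem_filter, mem_univ, true_and, bp_inc G F hF])]
    ring
  · apply Finset.sum_eq_zero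
    intro W hW
    simp only [mem_filter, mem_univ, true_and] at hW
    refine absurd ⟨SimpleGraph.Coloring.mk (fun v => if v ∈ W then (0 : Fin 2) else 1) ?_⟩ hcol
    intro u v huv
    have := hW u v huv
    by_cases h : v ∈ W <;> simp_all
end

section
/- If a finite simple graph G is the disjoint union of two graphs G_1 and G_2, then for all elements x, y, z of a commutative ring, B(G;x,y,z) = B(G_1;x,y,z) · B(G_2;x,y,z). -/
open Finset

open scoped Classical

noncomputable def joinE {V₁ V₂ : Type*} (F₁ : Finset (Sym2 V₁)) (F₂ : Finset (Sym2 V₂)) :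
    Finset (Sym2 (V₁ ⊕ V₂)) :=
  F₁.image (Sym2.map Sum.inl) ∪ F₂.image (Sym2.map Sum.inr)

theorem joinE_ll {V₁ V₂ : Type*} (F₁ : Finset (Sym2 V₁)) (F₂ : Finset (Sym2 V₂)) (a b : V₁) :
    s(Sum.inl a, Sum.inl b) ∈ joinE F₁ F₂ ↔ s(a, b) ∈ F₁ := by
  simp only [joinE, mem_union, mem_image]
  constructor
  · rintro (⟨e, he, h⟩ | ⟨e, he, h⟩)
    · rw [← Sym2.map_mk] at h
      exact Sym2.map.injective Sum.inl_injective h ▸ he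
    · induction e with | _ u v => simp at h
  · intro h
    exact Or.inl ⟨_, h, rfl⟩

theorem joinE_rr {V₁ V₂ : Type*} (F₁ : Finset (Sym2 V₁)) (F₂ : Finset (Sym2 V₂)) (a b : V₂) :
    s(Sum.inr a, Sum.inr b) ∈ joinE F₁ F₂ ↔ s(a, b) ∈ F₂ := by
  simp only [joinE, mem_union, mem_image]
  constructor
  · rintro (⟨e, he, h⟩ | ⟨e, he, h⟩)
    · induction e with | _ u v => simp at h
    · rw [← Sym2.map_mk] at h
      exact Sym2.map.injective Sum.inr_injective h ▸ he
  · intro h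
    exact Or.inr ⟨_, h, rfl⟩

theorem joinE_lr {V₁ V₂ : Type*} (F₁ : Finset (Sym2 V₁)) (F₂ : Finset (Sym2 V₂)) (a : V₁)
    (b : V₂) : s(Sum.inl a, Sum.inr b) ∉ joinE F₁ F₂ := by
  simp only [joinE, mem_union, mem_image]
  rintro (⟨e, he, h⟩ | ⟨e, he, h⟩) <;> induction e with | _ u v => simp at h

theorem joinE_rl {V₁ V₂ : Type*} (F₁ : Finset (Sym2 V₁)) (F₂ : Finset (Sym2 V₂)) (a : V₁)
    (b : V₂) : s(Sum.inr b, Sum.inl a) ∉ joinE F₁ F₂ := by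
  rw [Sym2.eq_swap]; exact joinE_lr _ _ _ _

theorem joinE_card {V₁ V₂ : Type*} (F₁ : Finset (Sym2 V₁)) (F₂ : Finset (Sym2 V₂)) :
    (joinE F₁ F₂).card = F₁.card + F₂.card := by
  rw [joinE, card_union_of_disjoint, card_image_of_injective _ (Sym2.map.injective Sum.inl_injective),
    card_image_of_injective _ (Sym2.map.injective Sum.inr_injective)]
  rw [Finset.disjoint_left]
  intro e h1 h2
  simp only [mem_image] at h1 h2
  obtain ⟨u, -, rfl⟩ := h1
  obtain ⟨v, -, h⟩ := h2
  induction u with | _ a b => induction v with | _ c d => simp at h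

theorem edgeBoundary_sum {V₁ V₂ : Type*} [Fintype V₁] [Fintype V₂]
    (G₁ : SimpleGraph V₁) (G₂ : SimpleGraph V₂) (W₁ : Finset V₁) (W₂ : Finset V₂) :
    edgeBoundary (G₁ ⊕g G₂) (W₁.disjSum W₂) =
      joinE (edgeBoundary G₁ W₁) (edgeBoundary G₂ W₂) := by
  ext e
  induction e with | _ a b =>
  rcases a with a | a <;> rcases b with b | b <;>
    simp only [joinE_ll, joinE_rr, joinE_lr, joinE_rl] <;>
    simp [edgeBoundary]

theorem extNbr_sum {V₁ V₂ : Type*} [Fintype V₁] [Fintype V₂]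
    (F₁ : Finset (Sym2 V₁)) (F₂ : Finset (Sym2 V₂)) (W₁ : Finset V₁) (W₂ : Finset V₂) :
    extNbr (joinE F₁ F₂) (W₁.disjSum W₂) = (extNbr F₁ W₁).disjSum (extNbr F₂ W₂) := by
  ext v
  rcases v with v | v <;> simp [extNbr, joinE, or_and_right, exists_or]

theorem sum_powerset_joinE {V₁ V₂ : Type*} [Fintype V₁] [Fintype V₂] {R : Type*} [CommRing R]
    (A : Finset (Sym2 V₁)) (B : Finset (Sym2 V₂)) (f : Finset (Sym2 (V₁ ⊕ V₂)) → R) :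
    ∑ F ∈ (joinE A B).powerset, f F =
      ∑ p ∈ A.powerset ×ˢ B.powerset, f (joinE p.1 p.2) := by
  symm
  refine sum_bij' (fun p _ => joinE p.1 p.2)
    (fun F _ => (univ.filter fun e => Sym2.map Sum.inl e ∈ F,
      univ.filter fun e => Sym2.map Sum.inr e ∈ F)) ?_ ?_ ?_ ?_ ?_
  · rintro ⟨p, q⟩ h
    simp only [mem_product, mem_powerset] at h ⊢
    exact union_subset_union (image_subset_image h.1) (image_subset_image h.2)
  · intro F h
    simp only [mem_product, mem_powerset] at h ⊢
    constructor
    · intro e he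
      induction e with | _ a b =>
      exact (joinE_ll A B a b).1 (h (by simpa using he))
    · intro e he
      induction e with | _ a b =>
      exact (joinE_rr A B a b).1 (h (by simpa using he))
  · rintro ⟨p, q⟩ h
    refine Prod.ext ?_ ?_ <;> ext e <;> induction e with | _ a b =>
      simp [joinE_ll, joinE_rr]
  · intro F h
    simp only [mem_powerset] at h
    ext e
    induction e with | _ a b =>
    rcases a with a | a <;> rcases b with b | b
    · simp [joinE_ll]
    · exact iff_of_false (joinE_lr _ _ _ _) (fun k => joinE_lr _ _ _ _ (h k))
    · exact iff_of_false (joinE_rl _ _ _ _) (fun k => joinE_rl _ _ _ _ (h k))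
    · simp [joinE_rr]
  · intros; rfl

/-- Multiplicativity over disjoint unions:
`B(G₁ ⊕ G₂; x,y,z) = B(G₁;x,y,z) · B(G₂;x,y,z)`. -/
theorem bipartitionPoly_disjoint_union {V₁ V₂ : Type*} [Fintype V₁] [Fintype V₂]
    (G₁ : SimpleGraph V₁) (G₂ : SimpleGraph V₂) {R : Type*} [CommRing R] (x y z : R) :
    bipartitionPoly (G₁ ⊕g G₂) x y z =
      bipartitionPoly G₁ x y z * bipartitionPoly G₂ x y z := by
  unfold bipartitionPoly
  rw [← Equiv.sum_comp (Finset.sumEquiv (α := V₁) (β := V₂)).symm.toEquiv,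
    Fintype.sum_prod_type, sum_mul_sum]
  refine sum_congr rfl fun W₁ _ => sum_congr rfl fun W₂ _ => ?_
  change x ^ (W₁.disjSum W₂).card * ∑ F ∈ (edgeBoundary (G₁ ⊕g G₂) (W₁.disjSum W₂)).powerset,
    y ^ (extNbr F (W₁.disjSum W₂)).card * z ^ F.card = _
  rw [edgeBoundary_sum, sum_powerset_joinE, mul_mul_mul_comm, sum_mul_sum, sum_product,
    card_disjSum, pow_add]
  congr 1
  refine sum_congr rfl fun F₁ _ => sum_congr rfl fun F₂ _ => ?_
  simp only [extNbr_sum, joinE_card, card_disjSum, pow_add]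
  ring
end

section
/- Let G = (V,E) be a finite simple graph and v ∈ V. Then for all elements x, y, z of a commutative ring, B(G;x,y,z) = (1+x)·B(G−v;x,y,z) + ∑ z^{|F|} (x^{|S|} y^{|T|} + x^{|T|} y^{|S|}) · B(G−(S∪T);x,y,z), where the sum is over all connected bipartite subgraphs (S∪T, F) of G with at least one edge that contain the vertex v (S, T being the bipartition classes and F ⊆ E the edge set of the subgraph). -/
open Finset

open scoped Classical

/-- `(S ∪ T, F)` ranges over connected bipartite subgraphs with vertex set `U = S ∪ T`:
`F` is a nonempty set of edges of `G`, there is a bipartition `(S,T)` of `U` such that every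
edge of `F` joins `S` to `T`, the subgraph is connected, and every vertex of `U` is an
endpoint of an edge of `F`. -/
def IsConnBipSubgraph {V : Type*} (G : SimpleGraph V) (U : Finset V)
    (F : Finset (Sym2 V)) : Prop :=
  F.Nonempty ∧ (↑F : Set (Sym2 V)) ⊆ G.edgeSet ∧
    (∃ p : Finset V × Finset V, Disjoint p.1 p.2 ∧ p.1 ∪ p.2 = U ∧
      ∀ e ∈ F, ∃ u ∈ p.1, ∃ w ∈ p.2, e = s(u, w)) ∧
    (∀ u ∈ U, ∀ w ∈ U, (SimpleGraph.fromEdgeSet (↑F : Set (Sym2 V))).Reachable u w) ∧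
    (∀ u ∈ U, ∃ e ∈ F, u ∈ e)

/-- The factor `x^{|S|} y^{|T|} + x^{|T|} y^{|S|}` attached to a connected bipartite
subgraph with vertex set `U = S ∪ T` and edge set `F`; defined via choice (it is well
defined since the bipartition of a connected bipartite graph with at least one edge is
unique up to swapping, and the expression is symmetric under swapping). -/
noncomputable def bipFactor {V : Type*} (U : Finset V) (F : Finset (Sym2 V))
    {R : Type*} [CommRing R] (x y : R) : R :=
  if h : ∃ p : Finset V × Finset V, Disjoint p.1 p.2 ∧ p.1 ∪ p.2 = U ∧
      ∀ e ∈ F, ∃ u ∈ p.1, ∃ w ∈ p.2, e = s(u, w)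
  then x ^ h.choose.1.card * y ^ h.choose.2.card + x ^ h.choose.2.card * y ^ h.choose.1.card
  else 0

namespace BipAux

def Good {V : Type*} (G : SimpleGraph V) (W : Finset V) (F : Finset (Sym2 V)) : Prop :=
  ∀ e ∈ F, e ∈ G.edgeSet ∧ ∃ u ∈ W, ∃ w ∉ W, e = s(u, w)

noncomputable def T {V : Type*} [Fintype V] {R : Type*} [CommRing R] (x y z : R)
    (p : Finset V × Finset (Sym2 V)) : R :=
  x ^ p.1.card * (y ^ (extNbr p.2 p.1).card * z ^ p.2.card)

def P {V : Type*} (U : Finset V) (F1 F : Finset (Sym2 V)) : Prop :=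
  F1 ⊆ F ∧ ∀ e ∈ F, e ∉ F1 → ∀ u ∈ e, u ∉ U

lemma B_eq {V : Type*} [Fintype V] (G : SimpleGraph V) {R : Type*} [CommRing R] (x y z : R) :
    bipartitionPoly G x y z =
      ∑ p : Finset V × Finset (Sym2 V) with Good G p.1 p.2, T x y z p := by
  unfold bipartitionPoly
  rw [Finset.sum_filter, Fintype.sum_prod_type]
  refine Finset.sum_congr rfl fun W _ => ?_
  rw [Finset.mul_sum, ← Finset.sum_filter]
  refine Finset.sum_congr ?_ fun F _ => rfl
  ext F
  rw [Finset.mem_filter, Finset.mem_powerset]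
  simp [edgeBoundary, Good, Finset.subset_iff]

lemma B_induce {V : Type*} [Fintype V] (G : SimpleGraph V) (s : Set V) [Fintype s]
    {R : Type*} [CommRing R] (x y z : R) :
    bipartitionPoly (G.induce s) x y z =
      ∑ p : Finset V × Finset (Sym2 V) with
        (Good G p.1 p.2 ∧ (∀ w ∈ p.1, w ∈ s) ∧ (∀ e ∈ p.2, ∀ u ∈ e, u ∈ s)), T x y z p := by
  rw [B_eq]
  have hinj : Function.Injective (Sym2.map (Subtype.val : s → V)) :=
    Sym2.map.injective Subtype.val_injective
  refine Finset.sum_bij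
    (fun p _ => (p.1.map (Function.Embedding.subtype _), p.2.map ⟨_, hinj⟩)) ?_ ?_ ?_ ?_
  · rintro ⟨W, F⟩ h
    simp only [Finset.mem_filter, Finset.mem_univ, true_and] at h ⊢
    refine ⟨?_, ?_, ?_⟩
    · intro e he
      simp only [Finset.mem_map, Function.Embedding.coeFn_mk] at he
      obtain ⟨e, he, rfl⟩ := he
      obtain ⟨h1, u, hu, w, hw, rfl⟩ := h e he
      refine ⟨by simpa using h1, u, by simpa using hu, w, by simpa using hw, by simp⟩
    · intro w hw
      simp only [Finset.mem_map] at hw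
      obtain ⟨a, _, rfl⟩ := hw
      exact a.2
    · intro e he u hu
      simp only [Finset.mem_map, Function.Embedding.coeFn_mk] at he
      obtain ⟨e, he, rfl⟩ := he
      rw [Sym2.mem_map] at hu
      obtain ⟨a, _, rfl⟩ := hu
      exact a.2
  · rintro ⟨W, F⟩ _ ⟨W', F'⟩ _ h
    simpa using h
  · rintro ⟨W, F⟩ h
    simp only [Finset.mem_filter, Finset.mem_univ, true_and] at h
    obtain ⟨hG, hW, hF⟩ := h
    have h1 : W ⊆ (Finset.univ : Finset s).map (Function.Embedding.subtype _) := by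
      intro w hw
      simpa using hW w hw
    have h2 : F ⊆ (Finset.univ : Finset (Sym2 s)).map ⟨_, hinj⟩ := by
      intro e he
      obtain ⟨_, u, hu, w, hw, rfl⟩ := hG e he
      simp only [Finset.mem_map, Finset.mem_univ, true_and, Function.Embedding.coeFn_mk]
      exact ⟨s(⟨u, hF _ he u (by simp)⟩, ⟨w, hF _ he w (by simp)⟩), by simp⟩
    obtain ⟨W, _, rfl⟩ := Finset.subset_map_iff.1 h1
    obtain ⟨F, _, rfl⟩ := Finset.subset_map_iff.1 h2
    refine ⟨(W, F), ?_, rfl⟩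
    simp only [Finset.mem_filter, Finset.mem_univ, true_and]
    intro e he
    obtain ⟨h1, u, hu, w, hw, h3⟩ := hG (Sym2.map Subtype.val e)
      (Finset.mem_map.2 ⟨e, he, rfl⟩)
    simp only [Finset.mem_map] at hu
    obtain ⟨u, hu, rfl⟩ := hu
    have hws : w ∈ s := by
      have : w ∈ Sym2.map Subtype.val e := by rw [h3]; simp
      rw [Sym2.mem_map] at this
      obtain ⟨a, _, rfl⟩ := this
      exact a.2
    have h4 : e = s(u, ⟨w, hws⟩) := hinj (by rw [h3]; rfl)
    subst h4
    refine ⟨by simpa using h1, u, hu, ⟨w, hws⟩, ?_, rfl⟩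
    intro hc
    exact hw (Finset.mem_map.2 ⟨_, hc, rfl⟩)
  · rintro ⟨W, F⟩ h
    simp only [Finset.mem_filter, Finset.mem_univ, true_and] at h
    unfold T
    simp only [Finset.card_map]
    congr 3
    rw [← Finset.card_map (Function.Embedding.subtype (· ∈ s))]
    congr 1
    ext a
    simp only [extNbr, Finset.mem_map, Finset.mem_filter, Finset.mem_univ, true_and,
      Function.Embedding.coeFn_mk]
    constructor
    · rintro ⟨a, ⟨h1, e, he, hae⟩, rfl⟩
      refine ⟨?_, _, ⟨e, he, rfl⟩, Sym2.mem_map.2 ⟨a, hae, rfl⟩⟩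
      rintro ⟨b, hb, hba⟩
      exact h1 (Subtype.val_injective hba ▸ hb)
    · rintro ⟨h1, _, ⟨e, he, rfl⟩, hae⟩
      rw [Sym2.mem_map] at hae
      obtain ⟨b, hb, rfl⟩ := hae
      exact ⟨b, ⟨fun hc => h1 ⟨b, hc, rfl⟩, e, he, hb⟩, rfl⟩

lemma block {V : Type*} [Fintype V] (G : SimpleGraph V) (U S : Finset V) (F1 : Finset (Sym2 V))
    (hS : S ⊆ U) (hG : Good G S F1) (hF : ∀ e ∈ F1, ∀ u ∈ e, u ∈ U)
    {R : Type*} [CommRing R] (x y z : R) :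
    ∑ p : Finset V × Finset (Sym2 V) with (Good G p.1 p.2 ∧ P U F1 p.2 ∧ p.1 ∩ U = S), T x y z p
      = T x y z (S, F1) * bipartitionPoly (G.induce ((↑U : Set V)ᶜ)) x y z := by
  rw [B_induce, Finset.mul_sum]
  symm
  refine Finset.sum_bij' (fun p _ => (S ∪ p.1, F1 ∪ p.2)) (fun p _ => (p.1 \ U, p.2 \ F1))
    ?_ ?_ ?_ ?_ ?_
  · rintro ⟨W, F⟩ h
    simp only [Finset.mem_filter, Finset.mem_univ, true_and, Set.mem_compl_iff,
      Finset.mem_coe] at h ⊢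
    obtain ⟨h1, h2, h3⟩ := h
    refine ⟨?_, ⟨Finset.subset_union_left, ?_⟩, ?_⟩
    · intro e he
      rcases Finset.mem_union.1 he with he | he
      · obtain ⟨h4, u, hu, w, hw, rfl⟩ := hG e he
        have := hF _ he w (by simp)
        exact ⟨h4, u, by simp [hu], w, by simp only [Finset.mem_union]; grind, rfl⟩
      · obtain ⟨h4, u, hu, w, hw, rfl⟩ := h1 e he
        have := h3 _ he w (by simp)
        exact ⟨h4, u, by simp [hu], w, by simp only [Finset.mem_union]; grind, rfl⟩
    · intro e he hn
      exact h3 e (by grind)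
    · grind
  · rintro ⟨W, F⟩ h
    simp only [Finset.mem_filter, Finset.mem_univ, true_and, Set.mem_compl_iff,
      Finset.mem_coe] at h ⊢
    obtain ⟨h1, ⟨h2, h3⟩, h4⟩ := h
    refine ⟨?_, by grind, by grind⟩
    intro e he
    obtain ⟨he1, he2⟩ := Finset.mem_sdiff.1 he
    obtain ⟨h5, u, hu, w, hw, rfl⟩ := h1 e he1
    have := h3 _ he1 he2 u (by simp)
    exact ⟨h5, u, by grind, w, by grind, rfl⟩
  · rintro ⟨W, F⟩ h
    simp only [Finset.mem_filter, Finset.mem_univ, true_and, Set.mem_compl_iff,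
      Finset.mem_coe] at h ⊢
    obtain ⟨h1, h2, h3⟩ := h
    refine Prod.ext ?_ ?_
    · ext a; grind
    · ext e
      have : e ∈ F → e ∉ F1 := by
        intro he he'
        obtain ⟨_, u, _, w, _, rfl⟩ := h1 e he
        exact h3 _ he u (by simp) (hF _ he' u (by simp))
      simp only [Finset.mem_sdiff, Finset.mem_union]; tauto
  · rintro ⟨W, F⟩ h
    simp only [Finset.mem_filter, Finset.mem_univ, true_and] at h ⊢
    obtain ⟨h1, ⟨h2, h3⟩, h4⟩ := h
    refine Prod.ext ?_ ?_
    · ext a; grind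
    · exact Finset.union_sdiff_of_subset h2
  · rintro ⟨W, F⟩ h
    simp only [Finset.mem_filter, Finset.mem_univ, true_and, Set.mem_compl_iff,
      Finset.mem_coe] at h ⊢
    obtain ⟨h1, h2, h3⟩ := h
    unfold T
    have e1 : (S ∪ W).card = S.card + W.card := by
      apply Finset.card_union_of_disjoint
      rw [Finset.disjoint_left]; grind
    have e2 : (F1 ∪ F).card = F1.card + F.card := by
      apply Finset.card_union_of_disjoint
      rw [Finset.disjoint_left]
      intro e he' he
      obtain ⟨_, u, _, w, _, rfl⟩ := h1 e he
      exact h3 _ he u (by simp) (hF _ he' u (by simp))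
    have e3 : (extNbr (F1 ∪ F) (S ∪ W)).card = (extNbr F1 S).card + (extNbr F W).card := by
      rw [← Finset.card_union_of_disjoint]
      · congr 1
        ext a
        simp only [extNbr, Finset.mem_filter, Finset.mem_univ, true_and, Finset.mem_union]
        constructor
        · rintro ⟨h5, e, he | he, hae⟩
          · left; exact ⟨by tauto, e, he, hae⟩
          · right; exact ⟨by tauto, e, he, hae⟩
        · rintro (⟨h5, e, he, hae⟩ | ⟨h5, e, he, hae⟩)
          · have := hF e he a hae
            exact ⟨by grind, e, by tauto, hae⟩
          · have := h3 e he a hae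
            exact ⟨by grind, e, by tauto, hae⟩
      · rw [Finset.disjoint_left]
        intro a
        simp only [extNbr, Finset.mem_filter, Finset.mem_univ, true_and]
        rintro ⟨h5, e, he, hae⟩ ⟨h5, e', he', hae'⟩
        exact h3 e' he' a hae' (hF e he a hae)
    simp only [e1, e2, e3, pow_add]
    ring

lemma vpart {V : Type*} [Fintype V] (G : SimpleGraph V) (v : V)
    {R : Type*} [CommRing R] (x y z : R) :
    ∑ p : Finset V × Finset (Sym2 V) with (Good G p.1 p.2 ∧ ∀ e ∈ p.2, v ∉ e), T x y z p
      = (1 + x) * bipartitionPoly (G.induce ({v}ᶜ : Set V)) x y z := by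
  have h0 := block G {v} ∅ ∅ (by simp) (by simp [Good]) (by simp) x y z
  have h1 := block G {v} {v} ∅ (by simp) (by simp [Good]) (by simp) x y z
  have hB : bipartitionPoly (G.induce ((↑({v} : Finset V) : Set V)ᶜ)) x y z =
      bipartitionPoly (G.induce ({v}ᶜ : Set V)) x y z := by
    rw [B_induce, B_induce]; simp
  have t0 : T x y z ((∅ : Finset V), (∅ : Finset (Sym2 V))) = 1 := by simp [T, extNbr]
  have t1 : T x y z (({v} : Finset V), (∅ : Finset (Sym2 V))) = x := by simp [T, extNbr]
  rw [hB, t0] at h0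
  rw [hB, t1] at h1
  rw [add_mul, ← h0, ← h1, ← Finset.sum_filter_add_sum_filter_not _ (fun p => v ∉ p.1),
    Finset.filter_filter, Finset.filter_filter]
  congr 1
  · refine Finset.sum_congr ?_ fun _ _ => rfl
    ext ⟨W, F⟩
    simp [P, Finset.inter_singleton, and_assoc]
    grind
  · refine Finset.sum_congr ?_ fun _ _ => rfl
    ext ⟨W, F⟩
    simp [P, Finset.inter_singleton, and_assoc]
    grind

lemma inner {V : Type*} [Fintype V] (G : SimpleGraph V) (U : Finset V) (F1 : Finset (Sym2 V))
    (hc : IsConnBipSubgraph G U F1) {R : Type*} [CommRing R] (x y z : R) :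
    ∑ p : Finset V × Finset (Sym2 V) with (Good G p.1 p.2 ∧ P U F1 p.2), T x y z p
      = z ^ F1.card * bipFactor U F1 x y *
          bipartitionPoly (G.induce ((↑U : Set V)ᶜ)) x y z := by
  obtain ⟨hne, hE, hp, hconn, hcov⟩ := hc
  unfold bipFactor
  rw [dif_pos hp]
  have hch := hp.choose_spec
  generalize hp.choose = p at hch
  obtain ⟨S, S'⟩ := p
  obtain ⟨hd, hU, hed⟩ := hch
  simp only at hd hU hed ⊢
  rw [Finset.disjoint_left] at hd
  have hF : ∀ e ∈ F1, ∀ u ∈ e, u ∈ U := by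
    intro e he u hu
    obtain ⟨a, ha, b, hb, rfl⟩ := hed e he
    rw [Sym2.mem_iff] at hu
    subst hU
    rcases hu with rfl | rfl <;> simp [ha, hb]
  have hS : S ⊆ U := hU ▸ Finset.subset_union_left
  have hS' : S' ⊆ U := hU ▸ Finset.subset_union_right
  have gS : Good G S F1 := by
    intro e he
    refine ⟨hE he, ?_⟩
    obtain ⟨a, ha, b, hb, rfl⟩ := hed e he
    exact ⟨a, ha, b, fun h => hd h hb, rfl⟩
  have gS' : Good G S' F1 := by
    intro e he
    refine ⟨hE he, ?_⟩
    obtain ⟨a, ha, b, hb, rfl⟩ := hed e he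
    exact ⟨b, hb, a, fun h => hd ha h, Sym2.eq_swap⟩
  have xS : extNbr F1 S = S' := by
    ext a
    simp only [extNbr, Finset.mem_filter, Finset.mem_univ, true_and]
    constructor
    · rintro ⟨h1, e, he, hae⟩
      have := hF e he a hae
      grind
    · intro h
      exact ⟨fun h' => hd h' h, hcov a (hS' h)⟩
  have xS' : extNbr F1 S' = S := by
    ext a
    simp only [extNbr, Finset.mem_filter, Finset.mem_univ, true_and]
    constructor
    · rintro ⟨h1, e, he, hae⟩
      have := hF e he a hae
      grind
    · intro h
      exact ⟨fun h' => hd h h', hcov a (hS h)⟩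
  have hneS : S ≠ S' := by
    rintro rfl
    obtain ⟨e, he⟩ := hne
    obtain ⟨a, ha, _⟩ := hed e he
    exact hd ha ha
  have b1 := block G U S F1 hS gS hF x y z
  have b2 := block G U S' F1 hS' gS' hF x y z
  have key : ∀ W F, Good G W F → P U F1 F → W ∩ U = S ∨ W ∩ U = S' := by
    intro W F hG hP
    have step : ∀ a b, (SimpleGraph.fromEdgeSet (↑F1 : Set (Sym2 V))).Reachable a b →
        ((a ∈ W ↔ a ∈ S) ↔ (b ∈ W ↔ b ∈ S)) := by
      intro a b hab
      rw [SimpleGraph.reachable_iff_reflTransGen] at hab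
      induction hab with
      | refl => rfl
      | tail h0 h ih =>
        rename_i c d
        rw [ih]
        rw [SimpleGraph.fromEdgeSet_adj] at h
        have hm : s(c, d) ∈ F1 := by simpa using h.1
        obtain ⟨_, u, hu, w, hw, h1⟩ := hG _ (hP.1 hm)
        obtain ⟨_, u', hu', w', hw', h2⟩ := gS _ hm
        rw [Sym2.eq_iff] at h1 h2
        grind
    obtain ⟨e, he⟩ := hne
    obtain ⟨a, ha, b, hb, rfl⟩ := hed e he
    by_cases haW : a ∈ W
    · left
      ext c
      have := fun hc => step a c (hconn a (hS ha) c hc)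
      grind
    · right
      ext c
      have := fun hc => step a c (hconn a (hS ha) c hc)
      grind
  have split : ∑ p : Finset V × Finset (Sym2 V) with (Good G p.1 p.2 ∧ P U F1 p.2), T x y z p =
      ∑ p : Finset V × Finset (Sym2 V) with (Good G p.1 p.2 ∧ P U F1 p.2 ∧ p.1 ∩ U = S), T x y z p
      + ∑ p : Finset V × Finset (Sym2 V) with
          (Good G p.1 p.2 ∧ P U F1 p.2 ∧ p.1 ∩ U = S'), T x y z p := by
    rw [← Finset.sum_filter_add_sum_filter_not _ (fun p => p.1 ∩ U = S),
      Finset.filter_filter, Finset.filter_filter]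
    congr 1
    · refine Finset.sum_congr ?_ fun _ _ => rfl
      ext ⟨W, F⟩
      simp [and_assoc]
    · refine Finset.sum_congr ?_ fun _ _ => rfl
      ext ⟨W, F⟩
      have := key W F
      simp only [Finset.mem_filter, Finset.mem_univ, true_and]
      grind
  rw [split, b1, b2]
  simp only [T, xS, xS']
  ring

lemma exU {V : Type*} [Fintype V] (G : SimpleGraph V) (v : V) (W : Finset V)
    (F : Finset (Sym2 V)) (hG : Good G W F) (hv : ∃ e ∈ F, v ∈ e) :
    ∃ U F1, IsConnBipSubgraph G U F1 ∧ v ∈ U ∧ P U F1 F := by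
  let H := SimpleGraph.fromEdgeSet (↑F : Set (Sym2 V))
  let U : Finset V := Finset.univ.filter fun w => H.Reachable v w
  let F1 := F.filter fun e => ∃ u ∈ e, u ∈ U
  have hvU : v ∈ U := by simp [U]
  have hne : ∀ {a b}, s(a, b) ∈ F → a ≠ b := fun h => G.ne_of_adj (hG _ h).1
  have hadj : ∀ {a b}, s(a, b) ∈ F → H.Adj a b := fun h => by
    simpa [H] using ⟨h, hne h⟩
  have hF : ∀ e ∈ F1, ∀ u ∈ e, u ∈ U := by
    intro e he u hu
    obtain ⟨he, w, hw, hwU⟩ := Finset.mem_filter.1 he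
    by_cases h : u = w
    · exact h ▸ hwU
    · have : e = s(w, u) := ((Sym2.mem_and_mem_iff (Ne.symm h)).1 ⟨hw, hu⟩)
      subst this
      simp only [U, Finset.mem_filter, Finset.mem_univ, true_and] at hwU ⊢
      exact hwU.trans (hadj he).reachable
  have hr : ∀ w ∈ U, (SimpleGraph.fromEdgeSet (↑F1 : Set (Sym2 V))).Reachable v w ∧
      ∃ e ∈ F1, w ∈ e := by
    intro w hw
    simp only [U, Finset.mem_filter, Finset.mem_univ, true_and] at hw
    rw [SimpleGraph.reachable_iff_reflTransGen] at hw
    induction hw with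
    | refl =>
      refine ⟨SimpleGraph.Reachable.refl _, ?_⟩
      obtain ⟨e, he, hve⟩ := hv
      exact ⟨e, Finset.mem_filter.2 ⟨he, v, hve, hvU⟩, hve⟩
    | tail h0 h ih =>
      rename_i c d
      have hm : s(c, d) ∈ F := by
        rw [SimpleGraph.fromEdgeSet_adj] at h
        simpa using h.1
      have hcU : c ∈ U := by
        simp only [U, Finset.mem_filter, Finset.mem_univ, true_and]
        rwa [SimpleGraph.reachable_iff_reflTransGen]
      have hm1 : s(c, d) ∈ F1 := Finset.mem_filter.2 ⟨hm, c, by simp, hcU⟩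
      refine ⟨ih.1.trans (SimpleGraph.Adj.reachable ?_), _, hm1, by simp⟩
      rw [SimpleGraph.fromEdgeSet_adj]
      exact ⟨by simpa using hm1, hne hm⟩
  refine ⟨U, F1, ⟨?_, ?_, ⟨(U ∩ W, U \ W), ?_, ?_, ?_⟩, ?_, ?_⟩, hvU, Finset.filter_subset _ _, ?_⟩
  · obtain ⟨e, he, _⟩ := (hr v hvU).2
    exact ⟨e, he⟩
  · intro e he
    exact (hG e (Finset.mem_filter.1 he).1).1
  · rw [Finset.disjoint_left]; grind
  · ext a; grind
  · intro e he
    obtain ⟨_, u, hu, w, hw, rfl⟩ := hG e (Finset.mem_filter.1 he).1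
    have h1 := hF _ he u (by simp)
    have h2 := hF _ he w (by simp)
    exact ⟨u, Finset.mem_inter.2 ⟨h1, hu⟩, w, Finset.mem_sdiff.2 ⟨h2, hw⟩, rfl⟩
  · intro u hu w hw
    exact (hr u hu).1.symm.trans (hr w hw).1
  · exact fun u hu => (hr u hu).2
  · intro e he hn u hu huU
    exact hn (Finset.mem_filter.2 ⟨he, u, hu, huU⟩)

lemma inU {V : Type*} {G : SimpleGraph V} {U : Finset V} {F1 : Finset (Sym2 V)}
    (hc : IsConnBipSubgraph G U F1) : ∀ e ∈ F1, ∀ u ∈ e, u ∈ U := by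
  obtain ⟨hne, hE, ⟨p, hd, rfl, hed⟩, hconn, hcov⟩ := hc
  intro e he u hu
  obtain ⟨a, ha, b, hb, rfl⟩ := hed e he
  rw [Sym2.mem_iff] at hu
  rcases hu with rfl | rfl <;> simp [ha, hb]

lemma charU {V : Type*} [Fintype V] {G : SimpleGraph V} {v : V} {F : Finset (Sym2 V)}
    {U : Finset V} {F1 : Finset (Sym2 V)} (hc : IsConnBipSubgraph G U F1) (hv : v ∈ U)
    (hP : P U F1 F) : (∀ w, w ∈ U ↔ (SimpleGraph.fromEdgeSet (↑F : Set (Sym2 V))).Reachable v w) ∧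
      (∀ e, e ∈ F1 ↔ e ∈ F ∧ ∃ u ∈ e, u ∈ U) := by
  have hin := inU hc
  constructor
  · intro w
    constructor
    · intro hw
      exact (hc.2.2.2.1 v hv w hw).mono
        (SimpleGraph.fromEdgeSet_mono (by exact_mod_cast hP.1))
    · intro hw
      rw [SimpleGraph.reachable_iff_reflTransGen] at hw
      induction hw with
      | refl => exact hv
      | tail h0 h ih =>
        rename_i c d
        have hm : s(c, d) ∈ F := by
          rw [SimpleGraph.fromEdgeSet_adj] at h
          simpa using h.1
        have hm1 : s(c, d) ∈ F1 := by
          by_contra hn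
          exact hP.2 _ hm hn c (by simp) ih
        exact hin _ hm1 d (by simp)
  · intro e
    constructor
    · intro he
      refine ⟨hP.1 he, ?_⟩
      induction e with
      | h a b => exact ⟨a, by simp, hin _ he a (by simp)⟩
    · rintro ⟨he, u, hu, huU⟩
      by_contra hn
      exact hP.2 _ he hn u hu huU

lemma count {V : Type*} [Fintype V] (G : SimpleGraph V) (v : V) (W : Finset V)
    (F : Finset (Sym2 V)) (hG : Good G W F) {R : Type*} [CommRing R] (t : R) :
    ∑ q : Finset V × Finset (Sym2 V) with
      ((IsConnBipSubgraph G q.1 q.2 ∧ v ∈ q.1) ∧ P q.1 q.2 F), t =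
      if ∀ e ∈ F, v ∉ e then 0 else t := by
  split_ifs with h
  · apply Finset.sum_eq_zero
    rintro ⟨U, F1⟩ hq
    simp only [Finset.mem_filter, Finset.mem_univ, true_and] at hq
    obtain ⟨⟨hc, hv⟩, hP⟩ := hq
    obtain ⟨e, he, hve⟩ := hc.2.2.2.2 v hv
    exact absurd hve (h e (hP.1 he))
  · push Not at h
    obtain ⟨U, F1, hc, hv, hP⟩ := exU G v W F hG h
    have : (Finset.univ.filter fun q : Finset V × Finset (Sym2 V) =>
        ((IsConnBipSubgraph G q.1 q.2 ∧ v ∈ q.1) ∧ P q.1 q.2 F)) = {(U, F1)} := by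
      ext ⟨U', F1'⟩
      simp only [Finset.mem_filter, Finset.mem_univ, true_and, Finset.mem_singleton]
      constructor
      · rintro ⟨⟨hc', hv'⟩, hP'⟩
        have h1 := charU hc hv hP
        have h2 := charU hc' hv' hP'
        have hU : U' = U := by
          ext w; rw [h1.1, h2.1]
        subst hU
        have hF : F1' = F1 := by
          ext e; rw [h1.2, h2.2]
        rw [hF]
      · intro h
        simp only [Prod.mk.injEq] at h
        obtain ⟨rfl, rfl⟩ := h
        exact ⟨⟨hc, hv⟩, hP⟩
    rw [this, Finset.sum_singleton]

end BipAux

/-- Vertex-deletion decomposition: for every vertex `v`,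
`B(G) = (1+x)·B(G−v) + ∑_{(S∪T,F) conn. bip. subgraph, v ∈ S∪T}
  z^{|F|} (x^{|S|}y^{|T|} + x^{|T|}y^{|S|}) · B(G−(S∪T))`. -/
theorem bipartitionPoly_vertex_deletion {V : Type*} [Fintype V] (G : SimpleGraph V)
    (v : V) {R : Type*} [CommRing R] (x y z : R) :
    bipartitionPoly G x y z =
      (1 + x) * bipartitionPoly (G.induce ({v}ᶜ : Set V)) x y z +
        ∑ U : Finset V, ∑ F ∈ G.edgeFinset.powerset,
          if IsConnBipSubgraph G U F ∧ v ∈ U then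
            z ^ F.card * bipFactor U F x y *
              bipartitionPoly (G.induce ((↑U : Set V)ᶜ)) x y z
          else 0 := by
  have hR : (∑ U : Finset V, ∑ F ∈ G.edgeFinset.powerset,
      if IsConnBipSubgraph G U F ∧ v ∈ U then
        z ^ F.card * bipFactor U F x y *
          bipartitionPoly (G.induce ((↑U : Set V)ᶜ)) x y z
      else 0) =
      ∑ q : Finset V × Finset (Sym2 V) with (IsConnBipSubgraph G q.1 q.2 ∧ v ∈ q.1),
        ∑ p : Finset V × Finset (Sym2 V) with
          (BipAux.Good G p.1 p.2 ∧ BipAux.P q.1 q.2 p.2), BipAux.T x y z p := by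
    rw [Finset.sum_filter, Fintype.sum_prod_type]
    refine Finset.sum_congr rfl fun U _ => ?_
    rw [← Finset.sum_subset (Finset.subset_univ G.edgeFinset.powerset)]
    · refine Finset.sum_congr rfl fun F _ => ?_
      split_ifs with h
      · exact (BipAux.inner G U F h.1 x y z).symm
      · rfl
    · intro F _ hF
      rw [if_neg]
      rintro ⟨hc, _⟩
      apply hF
      rw [Finset.mem_powerset]
      intro e he
      simpa using hc.2.1 he
  rw [hR, ← BipAux.vpart, BipAux.B_eq]
  rw [Finset.sum_comm' (t' := Finset.univ.filter fun p => BipAux.Good G p.1 p.2)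
    (s' := fun p => Finset.univ.filter fun q =>
      ((IsConnBipSubgraph G q.1 q.2 ∧ v ∈ q.1) ∧ BipAux.P q.1 q.2 p.2))
    (by intro q p; simp only [Finset.mem_filter, Finset.mem_univ, true_and]; tauto)]
  rw [← Finset.filter_filter, Finset.sum_filter (fun p : Finset V × Finset (Sym2 V) => ∀ e ∈ p.2, v ∉ e), ← Finset.sum_add_distrib]
  refine Finset.sum_congr rfl fun p hp => ?_
  rw [BipAux.count G v p.1 p.2 (Finset.mem_filter.1 hp).2]
  split_ifs <;> simp
end

section
/- Let G = (V,E) be a finite simple graph and e ∈ E. Then for all elements x, y, z of a commutative ring, B(G;x,y,z) = B(G−e;x,y,z) + ∑ z^{|F|} (x^{|S|} y^{|T|} + x^{|T|} y^{|S|}) · B(G−(S∪T);x,y,z), where the sum is over all connected bipartite subgraphs (S∪T, F) of G whose edge set F contains e (S, T being the bipartition classes and F ⊆ E the edge set of the subgraph). -/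
open Finset

open scoped Classical

noncomputable def compV {V : Type*} [Fintype V] (F : Finset (Sym2 V)) (a : V) : Finset V :=
  Finset.univ.filter fun v => (SimpleGraph.fromEdgeSet (↑F : Set (Sym2 V))).Reachable a v

noncomputable def compE {V : Type*} [Fintype V] (F : Finset (Sym2 V)) (a : V) :
    Finset (Sym2 V) :=
  F.filter fun f => ∃ v ∈ compV F a, v ∈ f

theorem reach_induct {V : Type*} (F : Finset (Sym2 V)) (a : V) (P : V → Prop) (h0 : P a)
    (hs : ∀ v w, (SimpleGraph.fromEdgeSet (↑F : Set (Sym2 V))).Reachable a v →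
      s(v, w) ∈ F → v ≠ w → P v → P w) (v : V)
    (h : (SimpleGraph.fromEdgeSet (↑F : Set (Sym2 V))).Reachable a v) : P v := by
  rw [SimpleGraph.reachable_iff_reflTransGen] at h
  induction h with
  | refl => exact h0
  | tail h1 h2 ih =>
    rw [← SimpleGraph.reachable_iff_reflTransGen] at h1
    rw [SimpleGraph.fromEdgeSet_adj] at h2
    exact hs _ _ h1 (by simpa using h2.1) h2.2 ih

theorem mem_boundary {V : Type*} [Fintype V] (G : SimpleGraph V) (W : Finset V) (f : Sym2 V) :
    f ∈ edgeBoundary G W ↔ f ∈ G.edgeSet ∧ ∃ u ∈ W, ∃ v ∉ W, f = s(u, v) := by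
  simp [edgeBoundary]

theorem comp_conn {V : Type*} [Fintype V] (G : SimpleGraph V) (W : Finset V)
    (F : Finset (Sym2 V)) (hF : F ⊆ edgeBoundary G W) (a b : V) (hab : s(a, b) ∈ F) :
    IsConnBipSubgraph G (compV F a) (compE F a) ∧ s(a, b) ∈ compE F a := by
  have ha : a ∈ compV F a := by simp [compV]
  have he : s(a, b) ∈ compE F a := by
    simp only [compE, Finset.mem_filter]
    exact ⟨hab, a, ha, by simp⟩
  have step : ∀ v w, v ∈ compV F a → s(v, w) ∈ F → w ∈ compV F a := by
    intro v w hv hvw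
    simp only [compV, Finset.mem_filter, Finset.mem_univ, true_and] at hv ⊢
    by_cases h : v = w
    · rwa [← h]
    · refine hv.trans (SimpleGraph.Adj.reachable ?_)
      rw [SimpleGraph.fromEdgeSet_adj]
      exact ⟨by simpa using hvw, h⟩
  have hr : ∀ v ∈ compV F a,
      (SimpleGraph.fromEdgeSet (↑(compE F a) : Set (Sym2 V))).Reachable a v := by
    intro v hv
    simp only [compV, Finset.mem_filter, Finset.mem_univ, true_and] at hv
    refine reach_induct F a _ (SimpleGraph.Reachable.refl _) ?_ v hv
    intro v w hv hvw hne ih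
    refine ih.trans (SimpleGraph.Adj.reachable ?_)
    rw [SimpleGraph.fromEdgeSet_adj]
    refine ⟨?_, hne⟩
    simp only [compE, Finset.coe_filter, Set.mem_ofPred_eq]
    exact ⟨hvw, v, by simpa [compV] using hv, by simp⟩
  refine ⟨⟨⟨_, he⟩, ?_, ?_, ?_, ?_⟩, he⟩
  · intro f hf
    have : f ∈ F := (Finset.mem_filter.1 (Finset.mem_coe.1 hf)).1
    exact ((mem_boundary _ _ _).1 (hF this)).1
  · refine ⟨(compV F a ∩ W, compV F a \ W), ?_, ?_, ?_⟩
    · rw [Finset.disjoint_left]; intro v; simp; tauto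
    · ext v; simp; tauto
    · intro f hf
      obtain ⟨hf1, c, hc, hcf⟩ := Finset.mem_filter.1 hf
      obtain ⟨_, u, hu, w, hw, rfl⟩ := (mem_boundary _ _ _).1 (hF hf1)
      have : u ∈ compV F a ∧ w ∈ compV F a := by
        rcases Sym2.mem_iff.1 hcf with rfl | rfl
        · exact ⟨hc, step _ _ hc hf1⟩
        · exact ⟨step _ _ hc (by rwa [Sym2.eq_swap]), hc⟩
      exact ⟨u, by simp [this, hu], w, by simp [this, hw], rfl⟩
  · intro u hu w hw
    exact (hr u hu).symm.trans (hr w hw)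
  · intro u hu
    have hu' := hu
    simp only [compV, Finset.mem_filter, Finset.mem_univ, true_and] at hu
    refine reach_induct F a (fun u => ∃ e ∈ compE F a, u ∈ e) ⟨_, he, by simp⟩ ?_ u hu
    intro v w hv hvw _ _
    refine ⟨s(v, w), ?_, by simp⟩
    simp only [compE, Finset.mem_filter]
    exact ⟨hvw, v, by simpa [compV] using hv, by simp⟩

theorem edge_sub {V : Type*} {G : SimpleGraph V} {U : Finset V}
    {F : Finset (Sym2 V)} (h : IsConnBipSubgraph G U F) {f : Sym2 V} (hf : f ∈ F) :
    ∀ v ∈ f, v ∈ U := by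
  obtain ⟨_, _, ⟨p, _, hp, h3⟩, _⟩ := h
  obtain ⟨u, hu, w, hw, rfl⟩ := h3 f hf
  intro v hv
  rw [← hp]
  rcases Sym2.mem_iff.1 hv with rfl | rfl <;> simp [hu, hw]

theorem comp_unique {V : Type*} [Fintype V] (G : SimpleGraph V) (U : Finset V)
    (F F' : Finset (Sym2 V)) (h : IsConnBipSubgraph G U F) (a b : V) (hab : s(a, b) ∈ F)
    (hF' : ∀ f ∈ F', ∀ v ∈ f, v ∉ U) :
    compV (F ∪ F') a = U ∧ compE (F ∪ F') a = F := by
  have ha : a ∈ U := edge_sub h hab a (by simp)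
  have h1 : compV (F ∪ F') a = U := by
    ext v
    simp only [compV, Finset.mem_filter, Finset.mem_univ, true_and]
    constructor
    · refine reach_induct _ a (· ∈ U) ha ?_ v
      intro v w _ hvw _ hv
      rcases Finset.mem_union.1 hvw with h2 | h2
      · exact edge_sub h h2 w (by simp)
      · exact absurd hv (hF' _ h2 v (by simp))
    · intro hv
      refine (h.2.2.2.1 a ha v hv).mono (SimpleGraph.fromEdgeSet_mono ?_)
      simp
  refine ⟨h1, ?_⟩
  ext f
  simp only [compE, h1, Finset.mem_filter, Finset.mem_union]
  constructor
  · rintro ⟨h2 | h2, v, hv, hvf⟩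
    · exact h2
    · exact absurd hv (hF' _ h2 v hvf)
  · intro hf
    obtain ⟨v, w⟩ := f
    exact ⟨Or.inl hf, v, edge_sub h hf v (by simp), by simp⟩

noncomputable def cuts {V : Type*} (U : Finset V) (F : Finset (Sym2 V)) : Finset (Finset V) :=
  U.powerset.filter fun S => ∀ f ∈ F, ∃ u ∈ S, ∃ w ∈ U \ S, f = s(u, w)

theorem bipFactor_eq {V : Type*} (G : SimpleGraph V) (U : Finset V)
    (F : Finset (Sym2 V)) (hc : IsConnBipSubgraph G U F) {R : Type*} [CommRing R] (x y : R) :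
    bipFactor U F x y = ∑ S ∈ cuts U F, x ^ S.card * y ^ (U \ S).card := by
  have h := hc.2.2.1
  rw [bipFactor, dif_pos h]
  obtain ⟨hd, hU, he⟩ := h.choose_spec
  generalize h.choose = p at hd hU he ⊢
  obtain ⟨S, T⟩ := p
  simp only at hd hU he ⊢
  have hd' : ∀ v, v ∈ S → v ∉ T := fun v hv => Finset.disjoint_left.1 hd hv
  have hU' : ∀ v, v ∈ U ↔ v ∈ S ∨ v ∈ T := by intro v; rw [← hU, Finset.mem_union]
  have hT : U \ S = T := by ext v; simp only [Finset.mem_sdiff, hU']; have := hd' v; tauto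
  have hS : U \ T = S := by ext v; simp only [Finset.mem_sdiff, hU']; have := hd' v; tauto
  obtain ⟨f, hf⟩ := hc.1
  obtain ⟨a, ha, b, hb, rfl⟩ := he f hf
  have hne : S ≠ T := by rintro rfl; exact hd' a ha ha
  have : cuts U F = {S, T} := by
    ext Q
    simp only [cuts, Finset.mem_filter, Finset.mem_powerset, Finset.mem_insert,
      Finset.mem_singleton]
    constructor
    · rintro ⟨hQ, hcut⟩
      have key : ∀ v ∈ U, ((v ∈ Q ↔ v ∈ S) ↔ (a ∈ Q ↔ a ∈ S)) := by
        intro v hv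
        refine reach_induct F a (fun v => ((v ∈ Q ↔ v ∈ S) ↔ (a ∈ Q ↔ a ∈ S))) Iff.rfl ?_ v
          (hc.2.2.2.1 a ((hU' a).2 (Or.inl ha)) v hv)
        intro v w _ hvw _ ih
        obtain ⟨u1, hu1, w1, hw1, e1⟩ := he _ hvw
        obtain ⟨u2, hu2, w2, hw2, e2⟩ := hcut _ hvw
        have := hd' u1
        have := hd' w1
        rw [Finset.mem_sdiff] at hw2
        simp only [Sym2.eq_iff] at e1 e2
        rcases e1 with ⟨rfl, rfl⟩ | ⟨rfl, rfl⟩ <;> rcases e2 with ⟨rfl, rfl⟩ | ⟨rfl, rfl⟩ <;> grind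
      by_cases haQ : a ∈ Q
      · left
        ext v
        have h1 := key v
        have h2 := hU' v
        have h3 := @hQ v
        grind
      · right
        ext v
        have h1 := key v
        have h2 := hU' v
        have h3 := @hQ v
        have h4 := hd' v
        grind
    · rintro (rfl | rfl)
      · refine ⟨fun v hv => (hU' v).2 (Or.inl hv), ?_⟩
        rwa [hT]
      · refine ⟨fun v hv => (hU' v).2 (Or.inr hv), ?_⟩
        rw [hS]
        intro f hf
        obtain ⟨u, hu, w, hw, rfl⟩ := he f hf
        exact ⟨w, hw, u, hu, Sym2.eq_swap⟩
  rw [this, Finset.sum_pair hne, hT, hS]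

noncomputable def term {V : Type*} [Fintype V] {R : Type*} [CommRing R] (x y z : R)
    (q : Finset V × Finset (Sym2 V)) : R :=
  x ^ q.1.card * (y ^ (extNbr q.2 q.1).card * z ^ q.2.card)

noncomputable def pairs {V : Type*} [Fintype V] (G : SimpleGraph V) :
    Finset (Finset V × Finset (Sym2 V)) :=
  Finset.univ.filter fun q => q.2 ⊆ edgeBoundary G q.1

noncomputable def pairsOff {V : Type*} [Fintype V] (G : SimpleGraph V) (U : Finset V) :
    Finset (Finset V × Finset (Sym2 V)) :=
  (pairs G).filter fun q => (∀ v ∈ q.1, v ∉ U) ∧ ∀ f ∈ q.2, ∀ v ∈ f, v ∉ U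

theorem poly_eq {V : Type*} [Fintype V] (G : SimpleGraph V) {R : Type*} [CommRing R]
    (x y z : R) : bipartitionPoly G x y z = ∑ q ∈ pairs G, term x y z q := by
  rw [bipartitionPoly, pairs, Finset.sum_filter, Fintype.sum_prod_type]
  refine Finset.sum_congr rfl fun W _ => ?_
  rw [← Finset.sum_filter, Finset.mul_sum]
  refine Finset.sum_congr ?_ fun F _ => rfl
  ext F; simp

theorem poly_induce {V : Type*} [Fintype V] (G : SimpleGraph V) (U : Finset V)
    {R : Type*} [CommRing R] (x y z : R) :
    bipartitionPoly (G.induce ((↑U : Set V)ᶜ)) x y z = ∑ q ∈ pairsOff G U, term x y z q := by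
  rw [poly_eq]
  let i : ((↑U : Set V)ᶜ : Set V) ↪ V := Function.Embedding.subtype _
  refine Finset.sum_bij (fun q _ => (q.1.map i, q.2.map i.sym2Map)) ?_ ?_ ?_ ?_
  · rintro ⟨W, F⟩ hq
    simp only [pairs, pairsOff, Finset.mem_filter, Finset.mem_univ, true_and] at hq ⊢
    refine ⟨?_, ?_, ?_⟩
    · intro f hf
      obtain ⟨g, hg, rfl⟩ := Finset.mem_map.1 hf
      obtain ⟨h1, u, hu, v, hv, rfl⟩ := (mem_boundary _ _ _).1 (hq hg)
      rw [mem_boundary]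
      refine ⟨by simpa [i] using h1, i u, by simpa using hu, i v, by simpa using hv, by simp⟩
    · intro v hv
      obtain ⟨g, hg, rfl⟩ := Finset.mem_map.1 hv
      exact g.2
    · intro f hf v hv
      obtain ⟨g, hg, rfl⟩ := Finset.mem_map.1 hf
      obtain ⟨c, d⟩ := g
      simp [i] at hv
      rcases hv with rfl | rfl
      · exact c.2
      · exact d.2
  · rintro ⟨W, F⟩ _ ⟨W', F'⟩ _ h
    simpa using h
  · rintro ⟨W, F⟩ hq
    simp only [pairs, pairsOff, Finset.mem_filter, Finset.mem_univ, true_and] at hq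
    obtain ⟨h1, h2, h3⟩ := hq
    have hW : (Finset.univ.filter fun v => i v ∈ W).map i = W := by
      ext v
      simp only [Finset.mem_map, Finset.mem_filter, Finset.mem_univ, true_and]
      constructor
      · rintro ⟨u, hu, rfl⟩; exact hu
      · intro hv; exact ⟨⟨v, h2 v hv⟩, hv, rfl⟩
    have hF : (Finset.univ.filter fun f => i.sym2Map f ∈ F).map i.sym2Map = F := by
      ext f
      simp only [Finset.mem_map, Finset.mem_filter, Finset.mem_univ, true_and]
      constructor
      · rintro ⟨u, hu, rfl⟩; exact hu
      · intro hf
        obtain ⟨c, d⟩ := f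
        exact ⟨s(⟨c, h3 _ hf c (by simp)⟩, ⟨d, h3 _ hf d (by simp)⟩), hf, rfl⟩
    refine ⟨(_, _), ?_, Prod.ext hW hF⟩
    simp only [pairs, Finset.mem_filter, Finset.mem_univ, true_and]
    intro f hf
    have hf' := (Finset.mem_filter.1 hf).2
    obtain ⟨h4, u, hu, v, hv, h5⟩ := (mem_boundary _ _ _).1 (h1 hf')
    have hu' := h3 _ hf' u (by simp [h5])
    have hv' := h3 _ hf' v (by simp [h5])
    have : f = s(⟨u, hu'⟩, ⟨v, hv'⟩) := i.sym2Map.injective h5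
    subst this
    rw [mem_boundary]
    exact ⟨by simpa [i] using h4, _, Finset.mem_filter.2 ⟨Finset.mem_univ _, hu⟩, _,
      fun h => hv (Finset.mem_filter.1 h).2, rfl⟩
  · rintro ⟨W, F⟩ _
    have : extNbr (F.map i.sym2Map) (W.map i) = (extNbr F W).map i := by
      ext v
      simp only [extNbr, Finset.mem_map, Finset.mem_filter, Finset.mem_univ, true_and]
      constructor
      · rintro ⟨h1, f, ⟨g, hg, rfl⟩, hv⟩
        obtain ⟨u, hu, rfl⟩ := Sym2.mem_map.1 hv
        exact ⟨u, ⟨fun h => h1 ⟨u, h, rfl⟩, g, hg, hu⟩, rfl⟩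
      · rintro ⟨u, ⟨h1, g, hg, hu⟩, rfl⟩
        refine ⟨?_, _, ⟨g, hg, rfl⟩, Sym2.mem_map.2 ⟨u, hu, rfl⟩⟩
        rintro ⟨u', hu', h⟩
        exact h1 (i.injective h ▸ hu')
    simp only [term, this, Finset.card_map]

theorem fiber_sum {V : Type*} [Fintype V] (G : SimpleGraph V) (a b : V) (U : Finset V)
    (F : Finset (Sym2 V)) (hc : IsConnBipSubgraph G U F) (hab : s(a, b) ∈ F)
    {R : Type*} [CommRing R] (x y z : R) :
    ∑ q ∈ ((pairs G).filter fun q => s(a, b) ∈ q.2) with (compV q.2 a, compE q.2 a) = (U, F),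
      term x y z q =
    z ^ F.card * (∑ S ∈ cuts U F, x ^ S.card * y ^ (U \ S).card) *
      ∑ q ∈ pairsOff G U, term x y z q := by
  rw [mul_assoc, Finset.sum_mul_sum, ← Finset.sum_product', Finset.mul_sum]
  symm
  refine Finset.sum_bij' (fun t _ => (t.1 ∪ t.2.1, F ∪ t.2.2))
    (fun q _ => (q.1 ∩ U, (q.1 \ U, q.2 \ F))) ?_ ?_ ?_ ?_ ?_
  · rintro ⟨S, W, F'⟩ ht
    simp only [cuts, pairsOff, pairs, Finset.mem_product, Finset.mem_filter, Finset.mem_univ,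
      true_and, Finset.mem_powerset] at ht ⊢
    obtain ⟨⟨hS, hcut⟩, hF', hW, hoff⟩ := ht
    obtain ⟨h1, h2⟩ := comp_unique G U F F' hc a b hab hoff
    refine ⟨⟨?_, Finset.mem_union_left _ hab⟩, by rw [h1, h2]⟩
    intro f hf
    rw [mem_boundary]
    rcases Finset.mem_union.1 hf with hf | hf
    · refine ⟨hc.2.1 hf, ?_⟩
      obtain ⟨u, hu, w, hw, rfl⟩ := hcut f hf
      refine ⟨u, by simp [hu], w, ?_, rfl⟩
      rw [Finset.mem_sdiff] at hw
      have := hW w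
      simp only [Finset.mem_union]; tauto
    · obtain ⟨h4, u, hu, v, hv, rfl⟩ := (mem_boundary _ _ _).1 (hF' hf)
      refine ⟨h4, u, by simp [hu], v, ?_, rfl⟩
      have := hoff _ hf v (by simp)
      have := @hS v
      simp only [Finset.mem_union]; tauto
  · rintro ⟨W, Q⟩ hq
    simp only [cuts, pairsOff, pairs, Finset.mem_product, Finset.mem_filter, Finset.mem_univ,
      true_and, Finset.mem_powerset, Prod.mk.injEq] at hq ⊢
    obtain ⟨⟨hQ, hQe⟩, hU, hF⟩ := hq
    have hFQ : F ⊆ Q := by rw [← hF]; exact Finset.filter_subset _ _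
    have hoff : ∀ f ∈ Q \ F, ∀ v ∈ f, v ∉ U := by
      intro f hf v hv hvU
      rw [Finset.mem_sdiff] at hf
      apply hf.2
      rw [← hF]
      exact Finset.mem_filter.2 ⟨hf.1, v, by rwa [hU], hv⟩
    refine ⟨⟨Finset.inter_subset_right, ?_⟩, ?_, ?_, hoff⟩
    · intro f hf
      have hs := edge_sub hc hf
      obtain ⟨h4, u, hu, v, hv, rfl⟩ := (mem_boundary _ _ _).1 (hQ (hFQ hf))
      refine ⟨u, by simp [hu, hs u], v, by simp [hv, hs v], rfl⟩
    · intro f hf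
      have hs := hoff f hf
      obtain ⟨h4, u, hu, v, hv, rfl⟩ := (mem_boundary _ _ _).1 (hQ (Finset.mem_sdiff.1 hf).1)
      rw [mem_boundary]
      exact ⟨h4, u, by simp [hu, hs u], v, by simp [hv], rfl⟩
    · intro v hv; exact (Finset.mem_sdiff.1 hv).2
  · rintro ⟨S, W, F'⟩ ht
    simp only [cuts, pairsOff, pairs, Finset.mem_product, Finset.mem_filter, Finset.mem_univ,
      true_and, Finset.mem_powerset] at ht
    obtain ⟨⟨hS, hcut⟩, hF', hW, hoff⟩ := ht
    simp only [Prod.mk.injEq]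
    refine ⟨?_, ?_, ?_⟩
    · ext v; have := @hS v; have := hW v; simp; tauto
    · ext v; have := @hS v; have := hW v; simp; tauto
    · ext f
      have : f ∈ F' → f ∉ F := by
        intro h1 h2
        obtain ⟨c, d⟩ := f
        exact hoff _ h1 c (by simp) (edge_sub hc h2 c (by simp))
      simp; tauto
  · rintro ⟨W, Q⟩ hq
    simp only [pairs, Finset.mem_filter, Finset.mem_univ, true_and, Prod.mk.injEq] at hq
    obtain ⟨⟨hQ, hQe⟩, hU, hF⟩ := hq
    have hFQ : F ⊆ Q := by rw [← hF]; exact Finset.filter_subset _ _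
    simp only [Prod.mk.injEq]
    constructor
    · ext v; simp; tauto
    · exact Finset.union_sdiff_of_subset hFQ
  · rintro ⟨S, W, F'⟩ ht
    simp only [cuts, pairsOff, pairs, Finset.mem_product, Finset.mem_filter, Finset.mem_univ,
      true_and, Finset.mem_powerset] at ht
    obtain ⟨⟨hS, hcut⟩, hF', hW, hoff⟩ := ht
    have c1 : (S ∪ W).card = S.card + W.card := by
      apply Finset.card_union_of_disjoint
      rw [Finset.disjoint_left]
      intro v h1 h2; exact hW v h2 (hS h1)
    have c2 : (F ∪ F').card = F.card + F'.card := by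
      apply Finset.card_union_of_disjoint
      rw [Finset.disjoint_left]
      intro f h2 h1
      obtain ⟨c, d⟩ := f
      exact hoff _ h1 c (by simp) (edge_sub hc h2 c (by simp))
    have c3 : (extNbr (F ∪ F') (S ∪ W)).card = (U \ S).card + (extNbr F' W).card := by
      rw [← Finset.card_union_of_disjoint]
      · congr 1
        ext v
        simp only [extNbr, Finset.mem_filter, Finset.mem_univ, true_and, Finset.mem_union,
          Finset.mem_sdiff, not_or]
        constructor
        · rintro ⟨⟨h1, h2⟩, f, hf | hf, hv⟩
          · exact Or.inl ⟨edge_sub hc hf v hv, h1⟩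
          · exact Or.inr ⟨h2, f, hf, hv⟩
        · rintro (⟨h1, h2⟩ | ⟨h1, f, hf, hv⟩)
          · obtain ⟨f, hf, hv⟩ := hc.2.2.2.2 v h1
            exact ⟨⟨h2, fun h => hW v h h1⟩, f, Or.inl hf, hv⟩
          · exact ⟨⟨fun h => hoff f hf v hv (hS h), h1⟩, f, Or.inr hf, hv⟩
      · rw [Finset.disjoint_left]
        intro v h1 h2
        simp only [extNbr, Finset.mem_filter, Finset.mem_univ, true_and] at h2
        obtain ⟨_, f, hf, hv⟩ := h2
        exact hoff f hf v hv (Finset.mem_sdiff.1 h1).1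
    simp only [term, c1, c2, c3]
    ring

/-- Edge-deletion decomposition: for every edge `e` of `G`,
`B(G) = B(G−e) + ∑_{(S∪T,F) conn. bip. subgraph, e ∈ F}
  z^{|F|} (x^{|S|}y^{|T|} + x^{|T|}y^{|S|}) · B(G−(S∪T))`. -/
theorem bipartitionPoly_edge_deletion {V : Type*} [Fintype V] (G : SimpleGraph V)
    (e : Sym2 V) (he : e ∈ G.edgeSet) {R : Type*} [CommRing R] (x y z : R) :
    bipartitionPoly G x y z =
      bipartitionPoly (G.deleteEdges {e}) x y z +
        ∑ U : Finset V, ∑ F ∈ G.edgeFinset.powerset,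
          if IsConnBipSubgraph G U F ∧ e ∈ F then
            z ^ F.card * bipFactor U F x y *
              bipartitionPoly (G.induce ((↑U : Set V)ᶜ)) x y z
          else 0 := by
  obtain ⟨a, b⟩ := e
  change s(a, b) ∈ _ at he
  change _ = bipartitionPoly (G.deleteEdges {s(a, b)}) x y z +
        ∑ U : Finset V, ∑ F ∈ G.edgeFinset.powerset,
          if IsConnBipSubgraph G U F ∧ s(a, b) ∈ F then
            z ^ F.card * bipFactor U F x y *
              bipartitionPoly (G.induce ((↑U : Set V)ᶜ)) x y z
          else 0
  rw [poly_eq G, poly_eq (G.deleteEdges {s(a, b)}),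
    ← Finset.sum_filter_not_add_sum_filter (pairs G) (fun q => s(a, b) ∈ q.2)]
  congr 1
  · refine Finset.sum_congr ?_ fun _ _ => rfl
    ext ⟨W, F⟩
    simp only [pairs, Finset.mem_filter, Finset.mem_univ, true_and]
    constructor
    · rintro ⟨h1, h2⟩ f hf
      have h3 := h1 hf
      rw [mem_boundary] at h3 ⊢
      refine ⟨?_, h3.2⟩
      rw [SimpleGraph.edgeSet_deleteEdges]
      exact ⟨h3.1, fun h => h2 (by rw [← Set.mem_singleton_iff.1 h]; exact hf)⟩
    · intro h1
      constructor
      · intro f hf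
        have h3 := h1 hf
        rw [mem_boundary, SimpleGraph.edgeSet_deleteEdges] at h3
        rw [mem_boundary]
        exact ⟨h3.1.1, h3.2⟩
      · intro h2
        have h3 := h1 h2
        rw [mem_boundary, SimpleGraph.edgeSet_deleteEdges] at h3
        exact h3.1.2 rfl
  · rw [← Finset.sum_fiberwise_of_maps_to (s := (pairs G).filter fun q => s(a, b) ∈ q.2)
      (t := (Finset.univ : Finset (Finset V)) ×ˢ G.edgeFinset.powerset)
      (g := fun q => (compV q.2 a, compE q.2 a)), Finset.sum_product]
    · refine Finset.sum_congr rfl fun U _ => Finset.sum_congr rfl fun F _ => ?_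
      split_ifs with h
      · rw [fiber_sum G a b U F h.1 h.2, bipFactor_eq G U F h.1, poly_induce]
      · apply Finset.sum_eq_zero
        rintro ⟨W, Q⟩ hq
        simp only [pairs, Finset.mem_filter, Finset.mem_univ, true_and, Prod.mk.injEq] at hq
        obtain ⟨⟨hQ, hQe⟩, hU, hF⟩ := hq
        exact absurd (hU ▸ hF ▸ comp_conn G W Q hQ a b hQe) h
    · rintro ⟨W, Q⟩ hq
      simp only [pairs, Finset.mem_filter, Finset.mem_univ, true_and] at hq
      have := (comp_conn G W Q hq.1 a b hq.2).1.2.1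
      simp only [Finset.mem_product, Finset.mem_univ, true_and, Finset.mem_powerset]
      intro f hf
      simpa using this hf
end

section
/- For every finite simple graph G = (V,E) of order n and every real number x with x ≠ −1, the domination polynomial satisfies D(G,x) = (1+x)^n · B(G; −1/(1+x), x/(1+x), −1). -/
open Finset

open scoped Classical

/-- The dominating sets of `G`: vertex sets `W` with `N_G[W] = V`. -/
noncomputable def dominatingSets {V : Type*} [Fintype V] (G : SimpleGraph V) :
    Finset (Finset V) :=
  Finset.univ.filter fun W => ∀ v : V, v ∈ W ∨ ∃ w ∈ W, G.Adj w v

lemma alt_sum_aux {α : Type*} (s : Finset α) :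
    ∑ m ∈ s.powerset, (-1 : ℝ) ^ m.card = if s = ∅ then 1 else 0 := by
  have h := Finset.sum_powerset_neg_one_pow_card (x := s)
  have h2 := congrArg (fun z : ℤ => (z : ℝ)) h
  push_cast at h2
  convert h2 using 1

lemma inner_aux {V : Type*} [Fintype V] (G : SimpleGraph V) (W : Finset V) (y : ℝ) :
    ∑ F ∈ (edgeBoundary G W).powerset, y ^ (extNbr F W).card * (-1) ^ F.card
      = (1 - y) ^ (extNbr (edgeBoundary G W) W).card := by
  set B := edgeBoundary G W with hB
  set N := extNbr B W with hN
  have h1 : ∀ F ∈ B.powerset, y ^ (extNbr F W).card * (-1) ^ F.card =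
      ∑ A ∈ N.powerset, ((1 - y) ^ A.card * y ^ (N \ A).card) *
        (if ∀ v ∈ A, v ∉ extNbr F W then (-1) ^ F.card else 0) := by
    intro F hF
    have hsub : extNbr F W ⊆ N := by
      intro v hv
      simp only [extNbr, hN, mem_filter, mem_univ, true_and] at hv ⊢
      obtain ⟨a, e, he, hve⟩ := hv
      exact ⟨a, e, mem_powerset.1 hF he, hve⟩
    have h2 : y ^ (extNbr F W).card =
        ∏ v ∈ N, ((if v ∉ extNbr F W then (1 - y) else 0) + y) := by
      rw [← Finset.prod_const, ← Finset.prod_subset hsub (f := fun v =>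
        ((if v ∉ extNbr F W then (1 - y) else 0) + y))]
      · apply Finset.prod_congr rfl
        intro v hv
        simp [hv]
      · intro v _ hv
        simp [hv]
    rw [h2, Finset.prod_add, Finset.sum_mul]
    apply Finset.sum_congr rfl
    intro A _
    rw [Finset.prod_ite_zero, Finset.prod_const, Finset.prod_const]
    split_ifs <;> ring
  rw [Finset.sum_congr rfl h1, Finset.sum_comm]
  have h3 : ∀ A ∈ N.powerset, ∑ F ∈ B.powerset, ((1 - y) ^ A.card * y ^ (N \ A).card) *
        (if ∀ v ∈ A, v ∉ extNbr F W then (-1 : ℝ) ^ F.card else 0)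
      = if A = N then (1 - y) ^ N.card else 0 := by
    intro A hA
    have hA' := mem_powerset.1 hA
    rw [← Finset.mul_sum, ← Finset.sum_filter]
    have h4 : B.powerset.filter (fun F => ∀ v ∈ A, v ∉ extNbr F W) =
        (B.filter (fun e => ∀ v ∈ A, v ∉ e)).powerset := by
      ext F
      simp only [mem_filter, mem_powerset, Finset.subset_iff]
      constructor
      · rintro ⟨h, h'⟩ e he
        refine ⟨h he, fun v hv hve => h' v hv ?_⟩
        have := hA' hv
        simp only [extNbr, hN, mem_filter, mem_univ, true_and] at this ⊢
        exact ⟨this.1, e, he, hve⟩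
      · intro h
        refine ⟨fun e he => (h he).1, fun v hv hv' => ?_⟩
        simp only [extNbr, mem_filter, mem_univ, true_and] at hv'
        obtain ⟨_, e, he, hve⟩ := hv'
        exact (h he).2 v hv hve
    rw [h4, alt_sum_aux]
    have h5 : B.filter (fun e => ∀ v ∈ A, v ∉ e) = ∅ ↔ A = N := by
      rw [Finset.filter_eq_empty_iff]
      constructor
      · intro h
        refine Finset.Subset.antisymm hA' fun v hv => ?_
        simp only [extNbr, hN, mem_filter, mem_univ, true_and] at hv
        obtain ⟨hvW, e, he, hve⟩ := hv
        have h6 := h he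
        push Not at h6
        obtain ⟨u, hu, hue⟩ := h6
        have huN := hA' hu
        simp only [extNbr, hN, mem_filter, mem_univ, true_and] at huN
        have huW := huN.1
        simp only [hB, edgeBoundary, mem_filter] at he
        obtain ⟨_, a, ha, b, hb, rfl⟩ := he
        rw [Sym2.mem_iff] at hve hue
        have : u = v := by
          rcases hve with rfl | rfl <;> rcases hue with rfl | rfl <;> first | rfl | contradiction
        exact this ▸ hu
      · rintro rfl e he h
        have he' := he
        simp only [hB, edgeBoundary, mem_filter] at he'
        obtain ⟨_, a, ha, b, hb, rfl⟩ := he'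
        refine h b ?_ (Sym2.mem_mk_right a b)
        simp only [extNbr, hN, mem_filter, mem_univ, true_and]
        exact ⟨hb, _, he, Sym2.mem_mk_right a b⟩
    by_cases h : A = N
    · rw [if_pos (h5.2 h), if_pos h, h]; simp
    · rw [if_neg (fun h' => h (h5.1 h')), if_neg h, mul_zero]
  rw [Finset.sum_congr rfl h3, Finset.sum_ite_eq' ]
  simp

lemma extNbr_aux {V : Type*} [Fintype V] (G : SimpleGraph V) (W : Finset V) (v : V) :
    v ∈ extNbr (edgeBoundary G W) W ↔ v ∉ W ∧ ∃ w ∈ W, G.Adj w v := by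
  simp only [extNbr, edgeBoundary, mem_filter, mem_univ, true_and]
  refine and_congr_right fun hv => ⟨?_, ?_⟩
  · rintro ⟨e, ⟨he, a, ha, b, hb, rfl⟩, hve⟩
    rw [Sym2.mem_iff] at hve
    rcases hve with rfl | rfl
    · contradiction
    · exact ⟨a, ha, by simpa using he⟩
  · rintro ⟨w, hw, hadj⟩
    exact ⟨s(w, v), ⟨by simpa using hadj, w, hw, v, hv, rfl⟩, Sym2.mem_mk_right w v⟩

/-- The domination polynomial satisfies
`D(G,x) = (1+x)^n · B(G; −1/(1+x), x/(1+x), −1)`. -/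
theorem dominationPoly_eq_bipartitionPoly {V : Type*} [Fintype V] (G : SimpleGraph V)
    (x : ℝ) (hx : x ≠ -1) :
    (∑ W ∈ dominatingSets G, x ^ W.card) =
      (1 + x) ^ Fintype.card V *
        bipartitionPoly G (-1 / (1 + x)) (x / (1 + x)) (-1) := by
  have hx1 : 1 + x ≠ 0 := fun h => hx (by linarith)
  have hy : 1 - x / (1 + x) = (1 + x)⁻¹ := by field_simp; ring
  unfold bipartitionPoly
  simp only [inner_aux, hy]
  rw [Finset.mul_sum]
  have h1 : ∀ W : Finset V, (1 + x) ^ Fintype.card V *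
      ((-1 / (1 + x)) ^ W.card * (1 + x)⁻¹ ^ (extNbr (edgeBoundary G W) W).card) =
      ∑ U : Finset V, if (∀ v ∈ U, v ∉ W ∧ ∀ w ∈ W, ¬ G.Adj w v) then
        x ^ U.card * (-1) ^ W.card else 0 := by
    intro W
    set N := extNbr (edgeBoundary G W) W with hN
    have hd : Disjoint W N := by
      rw [Finset.disjoint_right]
      intro v hv
      exact ((extNbr_aux G W v).1 hv).1
    have hc : Fintype.card V = (W ∪ N)ᶜ.card + (W.card + N.card) := by
      rw [← Finset.card_union_of_disjoint hd, Finset.card_compl_add_card]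
    rw [← Finset.sum_filter, ← Finset.sum_mul]
    have h2 : (univ.filter fun U : Finset V => ∀ v ∈ U, v ∉ W ∧ ∀ w ∈ W, ¬ G.Adj w v) =
        ((W ∪ N)ᶜ).powerset := by
      ext U
      simp only [mem_filter, mem_univ, true_and, mem_powerset, Finset.subset_iff, mem_compl,
        mem_union, hN, extNbr_aux]
      refine forall₂_congr fun v _ => ?_
      push Not
      tauto
    have h3 : ∑ U ∈ ((W ∪ N)ᶜ).powerset, x ^ U.card = (1 + x) ^ (W ∪ N)ᶜ.card := by
      have := Finset.sum_pow_mul_eq_add_pow x 1 (W ∪ N)ᶜ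
      simpa [add_comm] using this
    rw [h2, h3, hc, pow_add, pow_add, div_pow, inv_pow]
    field_simp
  rw [Finset.sum_congr rfl fun W _ => h1 W, Finset.sum_comm, dominatingSets, Finset.sum_filter]
  refine Finset.sum_congr rfl fun U _ => ?_
  rw [← Finset.sum_filter, ← Finset.mul_sum]
  have h4 : (univ.filter fun W : Finset V => ∀ v ∈ U, v ∉ W ∧ ∀ w ∈ W, ¬ G.Adj w v) =
      (univ.filter fun w : V => w ∉ U ∧ ∀ v ∈ U, ¬ G.Adj v w).powerset := by
    ext W
    simp only [mem_filter, mem_univ, true_and, mem_powerset, Finset.subset_iff]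
    constructor
    · intro h w hw
      exact ⟨fun hU => (h w hU).1 hw, fun v hv ha => (h v hv).2 w hw ha.symm⟩
    · intro h v hv
      exact ⟨fun hW => (h hW).1 hv, fun w hw ha => (h hw).2 v hv ha.symm⟩
  rw [h4, alt_sum_aux]
  have h5 : (univ.filter fun w : V => w ∉ U ∧ ∀ v ∈ U, ¬ G.Adj v w) = ∅ ↔
      ∀ v : V, v ∈ U ∨ ∃ w ∈ U, G.Adj w v := by
    rw [Finset.filter_eq_empty_iff]
    simp only [mem_univ, true_imp_iff]
    refine ⟨fun h v => ?_, fun h v => ?_⟩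
    · have := @h v
      by_contra! hc
      exact this hc
    · rintro ⟨h1, h2⟩
      rcases h v with h' | ⟨w, hw, ha⟩
      · exact h1 h'
      · exact h2 w hw ha
  by_cases h : ∀ v : V, v ∈ U ∨ ∃ w ∈ U, G.Adj w v
  · rw [if_pos h, if_pos (h5.2 h), mul_one]
  · rw [if_neg h, if_neg (fun h' => h (h5.1 h')), mul_zero]
end

section
/- For every finite simple graph G = (V,E) and all elements x, y of a commutative ring, B(G;x,1−y,−1) = ∑_{W⊆V} x^{|W|} y^{|N_G(W)|}, where N_G(W) is the open neighborhood of W. -/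
open Finset

open scoped Classical

lemma aux_sum {α β R : Type*} [CommRing R] (E : Finset α) (f : α → β) (y : R) :
    ∑ F ∈ E.powerset, (1 - y) ^ (F.image f).card * (-1) ^ F.card = y ^ (E.image f).card := by
  suffices H : ∀ A : Finset β, ∑ F ∈ E.powerset, (1 - y) ^ (F.image f ∪ A).card * (-1) ^ F.card
      = if Disjoint (E.image f) A then (1 - y) ^ A.card * y ^ (E.image f).card else 0 by
    simpa using H ∅
  induction E using Finset.induction_on with
  | empty => intro A; simp
  | insert a s ha ih =>
    intro A
    rw [Finset.sum_powerset_insert ha]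
    have h2 : ∑ t ∈ s.powerset, (1 - y) ^ ((insert a t).image f ∪ A).card * (-1) ^ (insert a t).card
        = - ∑ t ∈ s.powerset, (1 - y) ^ (t.image f ∪ insert (f a) A).card * (-1) ^ t.card := by
      rw [← Finset.sum_neg_distrib]
      refine Finset.sum_congr rfl fun t ht => ?_
      have hat : a ∉ t := fun h => ha (Finset.mem_powerset.1 ht h)
      rw [Finset.card_insert_of_notMem hat, Finset.image_insert, Finset.insert_union,
        Finset.union_insert]
      ring
    rw [h2, ih, ih, Finset.image_insert]
    simp only [Finset.disjoint_insert_left, Finset.disjoint_insert_right]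
    by_cases hA : Disjoint (s.image f) A <;> by_cases h1 : f a ∈ A <;>
      by_cases h3 : f a ∈ s.image f <;>
      first
      | exact absurd h1 (Finset.disjoint_left.1 hA h3)
      | skip
    all_goals
      simp only [hA, h1, h3, Finset.insert_eq_of_mem, Finset.card_insert_of_notMem, if_true,
        if_false, not_true, not_false_iff, and_true, true_and, and_false, false_and]
      ring

lemma aux_mem {V : Type*} [Fintype V] (G : SimpleGraph V) (W : Finset V) :
    ∃ f : Sym2 V → V, ∀ e ∈ edgeBoundary G W, ∀ v, (v ∉ W ∧ v ∈ e) ↔ f e = v := by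
  have : ∀ e : Sym2 V, ∃ w, e ∈ edgeBoundary G W → ∀ v, (v ∉ W ∧ v ∈ e) ↔ w = v := by
    intro e
    by_cases h : e ∈ edgeBoundary G W
    · obtain ⟨u, hu, w, hw, rfl⟩ := (Finset.mem_filter.1 h).2
      refine ⟨w, fun _ v => ?_⟩
      simp only [Sym2.mem_iff]
      constructor
      · rintro ⟨hv, rfl | rfl⟩
        · exact absurd hu hv
        · rfl
      · rintro rfl
        exact ⟨hw, Or.inr rfl⟩
    · exact ⟨e.out.1, fun h' => absurd h' h⟩
  choose f hf using this
  exact ⟨f, hf⟩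

/-- The generalized domination polynomial:
`B(G;x,1−y,−1) = ∑_{W⊆V} x^{|W|} y^{|N_G(W)|}`. -/
theorem bipartitionPoly_generalized_domination {V : Type*} [Fintype V]
    (G : SimpleGraph V) {R : Type*} [CommRing R] (x y : R) :
    bipartitionPoly G x (1 - y) (-1) =
      ∑ W : Finset V, x ^ W.card * y ^ (openNbhd G W).card := by
  unfold bipartitionPoly
  refine Finset.sum_congr rfl fun W _ => ?_
  congr 1
  obtain ⟨f, hf⟩ := aux_mem G W
  have key : ∀ F ⊆ edgeBoundary G W, extNbr F W = F.image f := by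
    intro F hF
    ext v
    simp only [extNbr, Finset.mem_filter, Finset.mem_univ, true_and, Finset.mem_image]
    constructor
    · rintro ⟨hv, e, he, hve⟩
      exact ⟨e, he, (hf e (hF he) v).1 ⟨hv, hve⟩⟩
    · rintro ⟨e, he, h⟩
      have := (hf e (hF he) v).2 h
      exact ⟨this.1, e, he, this.2⟩
  have hN : openNbhd G W = (edgeBoundary G W).image f := by
    rw [← key _ (Finset.Subset.refl _)]
    ext v
    simp only [extNbr, openNbhd, edgeBoundary, Finset.mem_filter, Finset.mem_univ, true_and]
    refine and_congr_right fun hv => ?_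
    constructor
    · rintro ⟨w, hw, h⟩
      exact ⟨s(w, v), ⟨by simpa using h, w, hw, v, hv, rfl⟩, by simp⟩
    · rintro ⟨e, ⟨he, u, hu, t, ht, rfl⟩, hve⟩
      rcases Sym2.mem_iff.1 hve with rfl | rfl
      · exact absurd hu hv
      · exact ⟨u, hu, by simpa using he⟩
  rw [hN, ← aux_sum]
  refine Finset.sum_congr rfl fun F hF => ?_
  rw [key F (Finset.mem_powerset.1 hF)]
end

section
/- A finite simple graph G = (V,E) of order n with k connected components is a forest if and only if its cut polynomial satisfies C(G,z) = (1+z)^{n−k} as polynomials in z, i.e., if and only if ∑_{W⊆V} z^{|∂W|} = 2^k (1+z)^{n−k} for all z. -/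
open Finset

open scoped Classical

theorem mem_eb {V : Type*} [Fintype V] (G : SimpleGraph V) (W : Finset V) (a b : V) :
    s(a, b) ∈ edgeBoundary G W ↔ G.Adj a b ∧ (a ∈ W ↔ b ∉ W) := by
  simp only [edgeBoundary, Finset.mem_filter, SimpleGraph.mem_edgeFinset, SimpleGraph.mem_edgeSet,
    and_congr_right_iff]
  intro _
  constructor
  · rintro ⟨u, hu, v, hv, h⟩
    rcases Sym2.eq_iff.1 h with ⟨rfl, rfl⟩ | ⟨rfl, rfl⟩ <;> tauto
  · intro h
    by_cases ha : a ∈ W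
    · exact ⟨a, ha, b, h.1 ha, rfl⟩
    · exact ⟨b, by tauto, a, ha, Sym2.eq_swap⟩

theorem eb_mono {V : Type*} [Fintype V] {F G : SimpleGraph V} (h : F ≤ G) (W : Finset V) :
    edgeBoundary F W ⊆ edgeBoundary G W := by
  intro e
  induction e with | _ a b
  rw [mem_eb, mem_eb]
  exact fun hh => ⟨h hh.1, hh.2⟩

theorem eb_card {V : Type*} [Fintype V] (G : SimpleGraph V) {u v : V} (huv : G.Adj u v)
    (W : Finset V) :
    (edgeBoundary G W).card = (edgeBoundary (G.deleteEdges {s(u, v)}) W).card +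
      if (u ∈ W ↔ v ∉ W) then 1 else 0 := by
  split_ifs with h
  · have hn : s(u, v) ∉ edgeBoundary (G.deleteEdges {s(u, v)}) W := by
      rw [mem_eb]; simp
    rw [← Finset.card_insert_of_notMem hn]
    congr 1
    ext e
    induction e with | _ a b
    rw [Finset.mem_insert, mem_eb, mem_eb, SimpleGraph.deleteEdges_adj, Set.mem_singleton_iff]
    by_cases he : s(a, b) = s(u, v)
    · have := (mem_eb G W u v).2 ⟨huv, h⟩
      rw [← he, mem_eb] at this
      tauto
    · tauto
  · rw [add_zero]
    congr 1
    ext e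
    induction e with | _ a b
    rw [mem_eb, mem_eb, SimpleGraph.deleteEdges_adj, Set.mem_singleton_iff]
    by_cases he : s(a, b) = s(u, v)
    · have : s(u, v) ∉ edgeBoundary G W := by
        rw [mem_eb]; tauto
      rw [← he, mem_eb] at this
      tauto
    · tauto

theorem cut_step {V : Type*} [Fintype V] (G : SimpleGraph V) {u v : V} (huv : G.Adj u v)
    (hb : ¬ (G.deleteEdges {s(u, v)}).Reachable u v) (z : ℝ) :
    2 * ∑ W : Finset V, z ^ (edgeBoundary G W).card =
      (1 + z) * ∑ W : Finset V, z ^ (edgeBoundary (G.deleteEdges {s(u, v)}) W).card := by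
  set G' := G.deleteEdges {s(u, v)} with hG'
  set C : Finset V := Finset.univ.filter fun w => G'.Reachable u w with hC
  have hu : u ∈ C := by simp [hC]
  have hv : v ∉ C := by simpa [hC] using hb
  have hadj : ∀ a b, G'.Adj a b → (a ∈ C ↔ b ∈ C) := by
    intro a b hab
    simp only [hC, Finset.mem_filter, Finset.mem_univ, true_and]
    exact ⟨fun h => h.trans hab.reachable, fun h => h.trans hab.symm.reachable⟩
  have hs : ∀ W, edgeBoundary G' (symmDiff W C) = edgeBoundary G' W := by
    intro W
    ext e
    induction e with | _ a b
    rw [mem_eb, mem_eb, and_congr_right_iff]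
    intro hab
    have := hadj a b hab
    rw [Finset.mem_symmDiff, Finset.mem_symmDiff]
    tauto
  have key : ∑ W : Finset V, z ^ (edgeBoundary G W).card =
      ∑ W : Finset V, z ^ (edgeBoundary G (symmDiff W C)).card := by
    have hinv : Function.Involutive (fun W : Finset V => symmDiff W C) :=
      fun W => symmDiff_symmDiff_cancel_right C W
    exact (Equiv.sum_comp hinv.toPerm (fun W => z ^ (edgeBoundary G W).card)).symm
  rw [two_mul]
  nth_rewrite 2 [key]
  rw [← Finset.sum_add_distrib, Finset.mul_sum]
  refine Finset.sum_congr rfl fun W _ => ?_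
  rw [eb_card G huv, eb_card G huv (symmDiff W C), ← hG', hs]
  have : (u ∈ symmDiff W C ↔ v ∉ symmDiff W C) ↔ ¬ (u ∈ W ↔ v ∉ W) := by
    rw [Finset.mem_symmDiff, Finset.mem_symmDiff]
    tauto
  by_cases h : (u ∈ W ↔ v ∉ W)
  · rw [if_pos h, if_neg (by tauto)]; ring
  · rw [if_neg h, if_pos (by tauto)]; ring

theorem forest_aux {V : Type*} [Fintype V] (m : ℕ) : ∀ (G : SimpleGraph V), G.IsAcyclic →
    G.edgeFinset.card = m → ∀ z : ℝ,
    2 ^ m * ∑ W : Finset V, z ^ (edgeBoundary G W).card =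
      2 ^ (Fintype.card V) * (1 + z) ^ m := by
  induction m with
  | zero =>
    intro G _ hm z
    have : ∀ W, edgeBoundary G W = ∅ := by
      intro W
      rw [edgeBoundary, Finset.card_eq_zero.1 hm, Finset.filter_empty]
    simp [this]
  | succ m ih =>
    intro G hG hm z
    obtain ⟨e, he⟩ : G.edgeFinset.Nonempty := Finset.card_pos.1 (by omega)
    induction e with | _ u v
    have huv : G.Adj u v := by simpa using he
    have hb := SimpleGraph.isAcyclic_iff_forall_adj_isBridge.1 hG huv
    rw [SimpleGraph.isBridge_iff] at hb
    have hle : G.deleteEdges {s(u, v)} ≤ G := SimpleGraph.deleteEdges_le _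
    have hc : (G.deleteEdges {s(u, v)}).edgeFinset.card = m := by
      have : (G.deleteEdges {s(u, v)}).edgeFinset = G.edgeFinset.erase s(u, v) := by
        ext e
        simp [SimpleGraph.edgeSet_deleteEdges, and_comm]
      rw [this, Finset.card_erase_of_mem he, hm]; rfl
    have h1 := ih _ (hG.anti hle) (by convert hc) z
    have h2 := cut_step G huv hb z
    rw [pow_succ, mul_assoc, h2, mul_left_comm, h1]
    ring

theorem cut_zero {V : Type*} [Fintype V] (G : SimpleGraph V) :
    ∑ W : Finset V, (0 : ℝ) ^ (edgeBoundary G W).card = 2 ^ numComponents G := by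
  have h : ∀ W : Finset V, (0 : ℝ) ^ (edgeBoundary G W).card =
      if edgeBoundary G W = ∅ then 1 else 0 := by
    intro W
    rw [zero_pow_eq]; simp
  simp_rw [h]
  rw [Finset.sum_boole]
  have : (2 : ℝ) ^ numComponents G =
      ((Finset.univ : Finset (Finset G.ConnectedComponent)).card : ℝ) := by
    rw [Finset.card_univ, Fintype.card_finset, numComponents]; push_cast; rfl
  rw [this]
  congr 1
  symm
  refine Finset.card_bij
    (fun S _ => Finset.univ.filter fun v => G.connectedComponentMk v ∈ S) ?_ ?_ ?_
  · intro S _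
    rw [Finset.mem_filter]
    refine ⟨Finset.mem_univ _, Finset.eq_empty_of_forall_notMem fun e => ?_⟩
    induction e with | _ a b
    rw [mem_eb]
    rintro ⟨hab, h⟩
    have : G.connectedComponentMk a = G.connectedComponentMk b :=
      SimpleGraph.ConnectedComponent.sound hab.reachable
    simp [this] at h
  · intro S _ T _ h
    ext c
    induction c using SimpleGraph.ConnectedComponent.ind with | _ v
    have := Finset.ext_iff.1 h v
    simpa using this
  · intro W hW
    rw [Finset.mem_filter] at hW
    have hadj : ∀ a b, G.Adj a b → (a ∈ W → b ∈ W) := by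
      intro a b hab ha
      by_contra hb
      have := (mem_eb G W a b).2 ⟨hab, by tauto⟩
      rw [hW.2] at this
      simp at this
    have hr : ∀ a b, G.Walk a b → (a ∈ W → b ∈ W) := by
      intro a b p
      induction p with
      | nil => exact id
      | cons h _ ih => exact fun ha => ih (hadj _ _ h ha)
    refine ⟨W.image G.connectedComponentMk, Finset.mem_univ _, ?_⟩
    ext v
    simp only [Finset.mem_filter, Finset.mem_univ, true_and, Finset.mem_image]
    constructor
    · rintro ⟨a, ha, h⟩
      obtain ⟨p⟩ := SimpleGraph.ConnectedComponent.exact h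
      exact hr _ _ p ha
    · exact fun h => ⟨v, h, rfl⟩

theorem forest_cut {V : Type*} [Fintype V] (G : SimpleGraph V) (hG : G.IsAcyclic) (z : ℝ) :
    ∑ W : Finset V, z ^ (edgeBoundary G W).card =
        2 ^ numComponents G * (1 + z) ^ (Fintype.card V - numComponents G) := by
  have h0 := forest_aux _ G hG rfl 0
  have hz := forest_aux _ G hG rfl z
  rw [cut_zero, add_zero, one_pow, mul_one, ← pow_add] at h0
  have h1 : G.edgeFinset.card + numComponents G = Fintype.card V :=
    pow_right_injective₀ (by norm_num : (0 : ℝ) < 2) (by norm_num) h0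
  have h2 : Fintype.card V - numComponents G = G.edgeFinset.card := by omega
  rw [h2]
  rw [← h1, pow_add, mul_assoc] at hz
  exact mul_left_cancel₀ (by positivity) hz

/-- A graph `G` of order `n` with `k` connected components is a forest if and only if its
cut polynomial satisfies `C(G,z) = (1+z)^{n−k}`, i.e.
`∑_{W⊆V} z^{|∂W|} = 2^k (1+z)^{n−k}` for all `z`. -/
theorem isAcyclic_iff_cutPoly {V : Type*} [Fintype V] (G : SimpleGraph V) :
    G.IsAcyclic ↔
      ∀ z : ℝ, ∑ W : Finset V, z ^ (edgeBoundary G W).card =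
        2 ^ numComponents G * (1 + z) ^ (Fintype.card V - numComponents G) := by
  refine ⟨forest_cut G, fun h => ?_⟩
  obtain ⟨F, hFG, hF, hr⟩ := G.exists_isAcyclic_reachable_eq_le
  have hk : numComponents F = numComponents G := by
    have e : F.ConnectedComponent ≃ G.ConnectedComponent :=
      Quot.congr (Equiv.refl V) (fun a b => by simp [hr])
    exact Fintype.card_congr e
  have h2 := forest_cut F hF 2
  rw [hk, ← h 2] at h2
  have hle : ∀ W ∈ (Finset.univ : Finset (Finset V)),
      (2 : ℝ) ^ (edgeBoundary F W).card ≤ 2 ^ (edgeBoundary G W).card := fun W _ =>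
    pow_le_pow_right₀ (by norm_num) (Finset.card_le_card (eb_mono hFG W))
  have heq := (Finset.sum_eq_sum_iff_of_le hle).1 h2
  have : G ≤ F := by
    intro u v huv
    have h3 : (edgeBoundary F {u}).card = (edgeBoundary G {u}).card :=
      pow_right_injective₀ (by norm_num : (0 : ℝ) < 2) (by norm_num) (heq {u} (Finset.mem_univ _))
    have h4 := Finset.eq_of_subset_of_card_le (eb_mono hFG {u}) h3.ge
    have h5 : s(u, v) ∈ edgeBoundary G {u} := by
      rw [mem_eb]
      exact ⟨huv, by simpa using huv.ne'⟩
    rw [← h4, mem_eb] at h5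
    exact h5.1
  exact hF.anti this
end

section
/- For every finite simple graph G = (V,E) of order n and size m, and every real number z with z ≠ −1, the Euler polynomial satisfies 𝓔(G,z) = ((1+z)^m / 2^n) · B(G; 1, 1, −2z/(1+z)). -/
open Finset

open scoped Classical

/-- The Euler polynomial `𝓔(G,z) = ∑_{F ⊆ E, (V,F) Eulerian} z^{|F|}`, where a spanning
subgraph `(V,F)` is Eulerian if every vertex has even degree in it. -/
noncomputable def eulerPoly {V : Type*} [Fintype V] (G : SimpleGraph V)
    {R : Type*} [CommRing R] (z : R) : R :=
  ∑ F ∈ G.edgeFinset.powerset.filter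
      (fun F : Finset (Sym2 V) => ∀ v : V, Even (F.filter (fun e => v ∈ e)).card),
    z ^ F.card

theorem aux_sigma {V : Type*} [Fintype V] (G : SimpleGraph V) (W : Finset V) (e : Sym2 V)
    (he : e ∈ G.edgeFinset) :
    (∏ v ∈ W, (if v ∈ e then (-1 : ℝ) else 1)) = if e ∈ edgeBoundary G W then -1 else 1 := by
  have hb : e ∈ edgeBoundary G W ↔ ∃ u ∈ W, ∃ v ∉ W, e = s(u, v) := by
    simp only [edgeBoundary, Finset.mem_filter, he, true_and]
  rw [Finset.prod_ite, Finset.prod_const, Finset.prod_const_one, mul_one]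
  simp only [hb]
  clear hb
  induction e using Sym2.ind with
  | _ a b =>
    have hab : a ≠ b := by
      have : G.Adj a b := by simpa using he
      exact this.ne
    have hf : W.filter (fun v => v ∈ s(a, b)) = ({a, b} : Finset V).filter (fun v => v ∈ W) := by
      ext v
      simp only [Finset.mem_filter, Sym2.mem_iff, Finset.mem_insert, Finset.mem_singleton]
      tauto
    have hB : (∃ u ∈ W, ∃ v ∉ W, s(a, b) = s(u, v)) ↔ (a ∈ W ∧ b ∉ W ∨ b ∈ W ∧ a ∉ W) := by
      constructor
      · rintro ⟨u, hu, v, hv, h⟩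
        rcases Sym2.eq_iff.1 h with ⟨rfl, rfl⟩ | ⟨rfl, rfl⟩
        · exact Or.inl ⟨hu, hv⟩
        · exact Or.inr ⟨hu, hv⟩
      · rintro (⟨h1, h2⟩ | ⟨h1, h2⟩)
        · exact ⟨a, h1, b, h2, rfl⟩
        · exact ⟨b, h1, a, h2, Sym2.eq_swap⟩
    rw [hf]
    simp only [hB]
    by_cases ha : a ∈ W <;> by_cases hb : b ∈ W <;>
      simp [Finset.filter_insert, Finset.filter_singleton, ha, hb, hab]

theorem aux_W {V : Type*} [Fintype V] (G : SimpleGraph V) (W : Finset V)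
    (z : ℝ) (hz : z ≠ -1) :
    (1 + z) ^ G.edgeFinset.card * ∑ F ∈ (edgeBoundary G W).powerset,
        (-2 * z / (1 + z)) ^ F.card =
      ∑ F ∈ G.edgeFinset.powerset, z ^ F.card *
        ∏ v ∈ W, (-1 : ℝ) ^ (F.filter (fun e => v ∈ e)).card := by
  have h1 : (1 + z) ≠ 0 := fun h => hz (by linarith)
  have hs : edgeBoundary G W ⊆ G.edgeFinset := Finset.filter_subset _ _
  have e1 : ∑ F ∈ (edgeBoundary G W).powerset, (-2 * z / (1 + z)) ^ F.card
      = ∏ e ∈ G.edgeFinset, (if e ∈ edgeBoundary G W then 1 + (-2 * z / (1 + z)) else 1) := by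
    rw [← Finset.prod_filter, Finset.filter_mem_eq_inter, Finset.inter_eq_right.2 hs,
      Finset.prod_one_add]
    simp only [Finset.prod_const]
  rw [e1, ← Finset.prod_const, ← Finset.prod_mul_distrib]
  have e2 : ∀ e ∈ G.edgeFinset,
      (1 + z) * (if e ∈ edgeBoundary G W then 1 + (-2 * z / (1 + z)) else 1) =
      1 + z * ∏ v ∈ W, (if v ∈ e then (-1 : ℝ) else 1) := by
    intro e he
    rw [aux_sigma G W e he]
    split_ifs
    · field_simp
      ring
    · ring
  rw [Finset.prod_congr rfl e2, Finset.prod_one_add]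
  refine Finset.sum_congr rfl fun F _ => ?_
  rw [Finset.prod_mul_distrib, Finset.prod_const, Finset.prod_comm]
  congr 1
  refine Finset.prod_congr rfl fun v _ => ?_
  rw [Finset.prod_ite, Finset.prod_const, Finset.prod_const_one, mul_one]

/-- The Euler polynomial satisfies `𝓔(G,z) = ((1+z)^m / 2^n) · B(G;1,1,−2z/(1+z))`. -/
theorem eulerPoly_eq_bipartitionPoly {V : Type*} [Fintype V] (G : SimpleGraph V)
    (z : ℝ) (hz : z ≠ -1) :
    eulerPoly G z =
      ((1 + z) ^ G.edgeFinset.card / 2 ^ Fintype.card V) *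
        bipartitionPoly G 1 1 (-2 * z / (1 + z)) := by
  have h2 : (2 : ℝ) ^ Fintype.card V ≠ 0 := by positivity
  rw [div_mul_eq_mul_div, eq_div_iff h2]
  unfold bipartitionPoly eulerPoly
  simp only [one_pow, one_mul]
  rw [Finset.mul_sum, Finset.sum_congr rfl (fun W _ => aux_W G W z hz), Finset.sum_comm,
    Finset.sum_filter, Finset.sum_mul]
  refine Finset.sum_congr rfl fun F _ => ?_
  rw [← Finset.mul_sum, ← Finset.powerset_univ, ← Finset.prod_one_add]
  split_ifs with h
  · rw [Finset.prod_congr rfl (fun v _ => by rw [(h v).neg_one_pow])]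
    norm_num
  · push Not at h
    obtain ⟨v, hv⟩ := h
    rw [Finset.prod_eq_zero (Finset.mem_univ v)]
    · simp
    · rw [(Nat.not_even_iff_odd.1 hv).neg_one_pow]
      norm_num
end

section
/- For every finite simple graph G = (V,E) of order n and size m, and every element z of a commutative ring, the Euler polynomial satisfies 2^n · 𝓔(G,z) = ∑_{W⊆V} (1+z)^{m−|∂W|} (1−z)^{|∂W|}. (Equivalently, for real z ≠ −1, 𝓔(G,z) = ((1+z)^m / 2^n) ∑_{W⊆V} ((1−z)/(1+z))^{|∂W|}.) -/
open Finset

open scoped Classical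

lemma edge_sign_aux {V : Type*} [Fintype V] (G : SimpleGraph V)
    {R : Type*} [CommRing R] (W : Finset V) (e : Sym2 V) (he : e ∈ G.edgeFinset) :
    (∏ v ∈ W, if v ∈ e then (-1 : R) else 1) =
      if (∃ u ∈ W, ∃ v ∉ W, e = s(u, v)) then -1 else 1 := by
  induction e using Sym2.ind with
  | _ a b =>
    have hab : a ≠ b := by
      rw [SimpleGraph.mem_edgeFinset, SimpleGraph.mem_edgeSet] at he
      exact he.ne
    have h1 : ∀ v : V, (if v ∈ s(a, b) then (-1 : R) else 1) =
        (if v = a then -1 else 1) * (if v = b then -1 else 1) := by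
      intro v
      by_cases h1 : v = a <;> by_cases h2 : v = b <;> simp_all
    have h2 : (∃ u ∈ W, ∃ v ∉ W, s(a, b) = s(u, v)) ↔ ((a ∈ W ∧ b ∉ W) ∨ (b ∈ W ∧ a ∉ W)) := by
      constructor
      · rintro ⟨u, hu, v, hv, h⟩
        rw [Sym2.eq_iff] at h
        rcases h with ⟨rfl, rfl⟩ | ⟨rfl, rfl⟩
        · exact Or.inl ⟨hu, hv⟩
        · exact Or.inr ⟨hu, hv⟩
      · rintro (⟨h, h'⟩ | ⟨h, h'⟩)
        · exact ⟨a, h, b, h', rfl⟩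
        · exact ⟨b, h, a, h', Sym2.eq_swap⟩
    simp only [h1, h2, Finset.prod_mul_distrib, Finset.prod_ite_eq']
    by_cases ha : a ∈ W <;> by_cases hb : b ∈ W <;> simp [ha, hb]

theorem eulerPoly_sum_over_vertex_subsets {V : Type*} [Fintype V] (G : SimpleGraph V)
    {R : Type*} [CommRing R] (z : R) :
    (2 : R) ^ Fintype.card V * eulerPoly G z =
      ∑ W : Finset V,
        (1 + z) ^ (G.edgeFinset.card - (edgeBoundary G W).card) *
          (1 - z) ^ (edgeBoundary G W).card := by
  have key : ∀ W : Finset V,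
      (1 + z) ^ (G.edgeFinset.card - (edgeBoundary G W).card) *
          (1 - z) ^ (edgeBoundary G W).card =
      ∑ F ∈ G.edgeFinset.powerset, z ^ F.card *
        ∏ v ∈ W, (-1 : R) ^ (F.filter (fun e => v ∈ e)).card := by
    intro W
    have e1 : (1 + z) ^ (G.edgeFinset.card - (edgeBoundary G W).card) *
          (1 - z) ^ (edgeBoundary G W).card =
        ∏ e ∈ G.edgeFinset, (1 + z * ∏ v ∈ W, if v ∈ e then (-1 : R) else 1) := by
      rw [Finset.prod_congr rfl (fun e he => by rw [edge_sign_aux G W e he])]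
      have : ∀ e : Sym2 V, (1 + z * if (∃ u ∈ W, ∃ v ∉ W, e = s(u, v)) then (-1 : R) else 1) =
          if (∃ u ∈ W, ∃ v ∉ W, e = s(u, v)) then 1 - z else 1 + z := by
        intro e
        split_ifs <;> ring
      rw [Finset.prod_congr rfl (fun e _ => this e), Finset.prod_ite, Finset.prod_const,
        Finset.prod_const, mul_comm]
      have hc := Finset.card_filter_add_card_filter_not (s := G.edgeFinset)
        (fun e => ∃ u ∈ W, ∃ v ∉ W, e = s(u, v))
      unfold edgeBoundary
      congr 2
      omega
    rw [e1, Finset.prod_one_add]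
    refine Finset.sum_congr rfl fun F _ => ?_
    rw [Finset.prod_mul_distrib, Finset.prod_const, Finset.prod_comm]
    congr 1
    refine Finset.prod_congr rfl fun v _ => ?_
    rw [Finset.prod_ite, Finset.prod_const, Finset.prod_const_one, mul_one]
  rw [Finset.sum_congr rfl (fun W _ => key W), Finset.sum_comm, eulerPoly, Finset.sum_filter,
    Finset.mul_sum]
  refine Finset.sum_congr rfl fun F _ => ?_
  rw [← Finset.mul_sum, ← Finset.powerset_univ, ← Finset.prod_one_add]
  split_ifs with h
  · rw [Finset.prod_congr rfl (fun v _ => by rw [(h v).neg_one_pow]), Finset.prod_const,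
      Finset.card_univ, one_add_one_eq_two, mul_comm]
  · push Not at h
    obtain ⟨v, hv⟩ := h
    rw [Finset.prod_eq_zero (Finset.mem_univ v), mul_zero, mul_zero]
    rw [(Nat.not_even_iff_odd.mp hv).neg_one_pow]
    ring
end

section
/- For every finite simple graph G = (V,E) of order n, the number d(G) of dominating sets of G satisfies d(G) = ∑_{W⊆V} (−1)^{|W|} · 2^{n−|N_G[W]|}. -/
open Finset

open scoped Classical

/-- The closed neighborhood `N_G[W]` of a vertex set `W`. -/
noncomputable def closedNbhd {V : Type*} [Fintype V] (G : SimpleGraph V) (W : Finset V) :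
    Finset V :=
  W ∪ Finset.univ.filter fun v => ∃ w ∈ W, G.Adj w v

/-- The number of dominating sets satisfies
`d(G) = ∑_{W⊆V} (−1)^{|W|} · 2^{n−|N_G[W]|}`. -/
theorem card_dominatingSets_eq_alternating_sum {V : Type*} [Fintype V]
    (G : SimpleGraph V) :
    ((dominatingSets G).card : ℤ) =
      ∑ W : Finset V,
        (-1 : ℤ) ^ W.card * 2 ^ (Fintype.card V - (closedNbhd G W).card) := by
  have h1 : ∀ W : Finset V, (2 : ℤ) ^ (Fintype.card V - (closedNbhd G W).card) =
      ∑ U : Finset V, if W ⊆ (closedNbhd G U)ᶜ then (1 : ℤ) else 0 := by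
    intro W
    rw [← Finset.card_compl, ← Finset.sum_filter, Finset.sum_const, nsmul_eq_mul, mul_one]
    have : (Finset.univ.filter fun U : Finset V => W ⊆ (closedNbhd G U)ᶜ) =
        ((closedNbhd G W)ᶜ).powerset := by
      ext U
      simp only [Finset.mem_filter, Finset.mem_univ, true_and, Finset.mem_powerset,
        Finset.subset_iff, Finset.mem_compl, closedNbhd, Finset.mem_union]
      constructor
      · rintro h x hx (hw | ⟨w, hw, ha⟩)
        · exact h hw (Or.inl hx)
        · exact h hw (Or.inr ⟨x, hx, ha.symm⟩)
      · rintro h x hx (hw | ⟨w, hw, ha⟩)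
        · exact h hw (Or.inl hx)
        · exact h hw (Or.inr ⟨x, hx, ha.symm⟩)
    rw [this, Finset.card_powerset]
    push_cast
    rfl
  simp_rw [h1, Finset.mul_sum]
  rw [Finset.sum_comm, dominatingSets, Finset.card_filter]
  push_cast
  refine Finset.sum_congr rfl fun U _ => ?_
  simp only [mul_ite, mul_one, mul_zero]
  rw [← Finset.sum_filter]
  have h2 : (Finset.univ.filter fun W : Finset V => W ⊆ (closedNbhd G U)ᶜ) =
      ((closedNbhd G U)ᶜ).powerset := by
    ext W
    simp
  rw [h2, Finset.sum_powerset_neg_one_pow_card]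
  refine if_congr ?_ rfl rfl
  rw [Finset.compl_eq_empty_iff, Finset.eq_univ_iff_forall]
  simp [closedNbhd]
end

section
/- Let G = (V,E) be a finite simple graph of order n. For all real numbers x with 2x−1 ≠ 0 and all real z, (2x−1)^n · B(G; 1/(2x−1), 1/(2x−1), z) = ∑_{F⊆E, (V,F) bipartite} 2^{k(V,F)} x^{iso(V,F)} z^{|F|}. Consequently, the number of bicolored subgraphs of G with exactly i isolated vertices and exactly j edges is the coefficient of x^i z^j in this expression. -/
open Finset

open scoped Classical

/-- `W` is a colour class of a proper 2-colouring of `H`. -/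
def GoodSet {V : Type*} (H : SimpleGraph V) (W : Finset V) : Prop :=
  ∀ u v, H.Adj u v → (u ∈ W ↔ v ∉ W)

lemma subset_edgeBoundary_iff {V : Type*} [Fintype V] (G : SimpleGraph V) (F : Finset (Sym2 V))
    (hF : F ⊆ G.edgeFinset) (W : Finset V) :
    F ⊆ edgeBoundary G W ↔ GoodSet (SimpleGraph.fromEdgeSet (↑F : Set (Sym2 V))) W := by
  constructor
  · intro h u v huv
    rw [SimpleGraph.fromEdgeSet_adj] at huv
    have h1 := h (Finset.mem_coe.1 huv.1)
    simp only [edgeBoundary, Finset.mem_filter] at h1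
    obtain ⟨-, a, ha, b, hb, hab⟩ := h1
    rw [Sym2.eq_iff] at hab
    rcases hab with ⟨rfl, rfl⟩ | ⟨rfl, rfl⟩ <;> tauto
  · intro h e he
    have heG := hF he
    simp only [edgeBoundary, Finset.mem_filter]
    refine ⟨heG, ?_⟩
    induction e using Sym2.ind with
    | _ u v =>
      have hadj : G.Adj u v := by simpa using heG
      have h1 := h u v (by
        rw [SimpleGraph.fromEdgeSet_adj]; exact ⟨Finset.mem_coe.2 he, hadj.ne⟩)
      by_cases hu : u ∈ W
      · exact ⟨u, hu, v, h1.1 hu, rfl⟩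
      · refine ⟨v, ?_, u, hu, Sym2.eq_swap⟩
        by_contra hv
        exact hu (h1.2 hv)

lemma exists_goodSet_iff {V : Type*} [Fintype V] (H : SimpleGraph V) :
    (∃ W, GoodSet H W) ↔ H.Colorable 2 := by
  constructor
  · rintro ⟨W, hW⟩
    refine ⟨SimpleGraph.Coloring.mk (fun v => if v ∈ W then (0 : Fin 2) else 1) ?_⟩
    intro u v huv
    have := hW u v huv
    by_cases hu : u ∈ W <;> by_cases hv : v ∈ W <;> simp_all
  · rintro ⟨c⟩
    refine ⟨Finset.univ.filter fun v => c v = 0, ?_⟩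
    intro u v huv
    have := c.valid huv
    simp only [Finset.mem_filter, Finset.mem_univ, true_and]
    constructor
    · intro h h'
      exact this (h.trans h'.symm)
    · intro h
      omega

lemma reach_xor {V : Type*} [Fintype V] (H : SimpleGraph V) (W W' : Finset V)
    (h : GoodSet H W) (h' : GoodSet H W') {u v : V} (huv : H.Reachable u v) :
    ((u ∈ W ↔ u ∈ W') ↔ (v ∈ W ↔ v ∈ W')) := by
  obtain ⟨p⟩ := huv
  induction p with
  | nil => rfl
  | cons hadj p ih =>
    rw [← ih]
    have := h _ _ hadj
    have := h' _ _ hadj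
    tauto

lemma sum_goodSet {V : Type*} [Fintype V] (H : SimpleGraph V) (I : Finset V)
    (hI : ∀ v, v ∈ I ↔ ∀ u, ¬ H.Adj v u) (x : ℝ) (hc : H.Colorable 2) :
    ∑ W ∈ Finset.univ.filter (GoodSet H), (2 * x - 1) ^ (I \ W).card =
      2 ^ numComponents H * x ^ I.card := by
  obtain ⟨W1, hW1⟩ := (exists_goodSet_iff H).2 hc
  obtain ⟨W0, hW0, hd⟩ : ∃ W0, GoodSet H W0 ∧ ∀ v ∈ I, v ∉ W0 := by
    refine ⟨W1 \ I, ?_, fun v hv h => (Finset.mem_sdiff.1 h).2 hv⟩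
    intro u v huv
    have h1 : u ∉ I := fun h => (hI u).1 h v huv
    have h2 : v ∉ I := fun h => (hI v).1 h u huv.symm
    have := hW1 u v huv
    simp [h1, h2, this]
  have hinj : Set.InjOn H.connectedComponentMk I := by
    intro u hu v _ huv
    obtain ⟨p⟩ := SimpleGraph.ConnectedComponent.exact huv
    cases p with
    | nil => rfl
    | cons hadj p => exact absurd hadj ((hI u).1 hu _)
  set J := I.image H.connectedComponentMk with hJ
  have hJc : J.card = I.card := Finset.card_image_of_injOn hinj
  have key : ∑ W ∈ Finset.univ.filter (GoodSet H), (2 * x - 1) ^ (I \ W).card =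
      ∑ C ∈ (Finset.univ : Finset H.ConnectedComponent).powerset, (2 * x - 1) ^ (J \ C).card := by
    symm
    refine Finset.sum_bij
      (fun C _ => Finset.univ.filter fun v => ¬ (v ∈ W0 ↔ H.connectedComponentMk v ∈ C)) ?_ ?_ ?_ ?_
    · intro C _
      simp only [Finset.mem_filter, Finset.mem_univ, true_and]
      intro u v huv
      have h1 := hW0 u v huv
      have h2 : H.connectedComponentMk u = H.connectedComponentMk v :=
        SimpleGraph.ConnectedComponent.sound huv.reachable
      simp only [Finset.mem_filter, Finset.mem_univ, true_and, h2]
      tauto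
    · intro C _ C' _ h
      ext c
      induction c using SimpleGraph.ConnectedComponent.ind with
      | _ v =>
        have := congrArg (v ∈ ·) h
        simp only [Finset.mem_filter, Finset.mem_univ, true_and, eq_iff_iff] at this
        tauto
    · intro W hW
      simp only [Finset.mem_filter, Finset.mem_univ, true_and] at hW
      refine ⟨(Finset.univ.filter fun v => ¬ (v ∈ W ↔ v ∈ W0)).image H.connectedComponentMk,
        by simp, ?_⟩
      ext v
      have hm : H.connectedComponentMk v ∈
          (Finset.univ.filter fun v => ¬ (v ∈ W ↔ v ∈ W0)).image H.connectedComponentMk ↔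
          ¬ (v ∈ W ↔ v ∈ W0) := by
        rw [Finset.mem_image]
        constructor
        · rintro ⟨u, hu, huv⟩
          simp only [Finset.mem_filter, Finset.mem_univ, true_and] at hu
          rwa [← reach_xor H W W0 hW hW0 (SimpleGraph.ConnectedComponent.exact huv)]
        · intro h
          exact ⟨v, by simpa using h, rfl⟩
      rw [Finset.mem_filter, hm]
      simp only [Finset.mem_univ, true_and]
      tauto
    · intro C _
      congr 1
      have : J \ C = (I \ (Finset.univ.filter fun v =>
          ¬ (v ∈ W0 ↔ H.connectedComponentMk v ∈ C))).image H.connectedComponentMk := by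
        ext c
        simp only [hJ, Finset.mem_sdiff, Finset.mem_image, Finset.mem_filter, Finset.mem_univ,
          true_and]
        constructor
        · rintro ⟨⟨v, hv, rfl⟩, hc⟩
          have := hd v hv
          exact ⟨v, ⟨hv, by tauto⟩, rfl⟩
        · rintro ⟨v, ⟨hv, hn⟩, rfl⟩
          have := hd v hv
          exact ⟨⟨v, hv, rfl⟩, by tauto⟩
      rw [this, Finset.card_image_of_injOn]
      exact hinj.mono (by intro v hv; simp at hv ⊢; exact hv.1)
  rw [key]
  have hp := Finset.prod_add (fun _ : H.ConnectedComponent => (1 : ℝ))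
    (fun c => if c ∈ J then 2 * x - 1 else 1) Finset.univ
  have e1 : ∀ C : Finset H.ConnectedComponent,
      (∏ i ∈ C, (1 : ℝ)) * ∏ c ∈ Finset.univ \ C, (if c ∈ J then 2 * x - 1 else 1) =
      (2 * x - 1) ^ (J \ C).card := by
    intro C
    rw [Finset.prod_const_one, one_mul, Finset.prod_ite, Finset.prod_const, Finset.prod_const_one,
      mul_one]
    congr 2
    ext c
    simp [and_comm]
  rw [← Finset.sum_congr rfl (fun C _ => e1 C), ← hp]
  have e2 : ∀ c : H.ConnectedComponent, (1 : ℝ) + (if c ∈ J then 2 * x - 1 else 1) =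
      2 * (if c ∈ J then x else 1) := by
    intro c
    split_ifs <;> ring
  rw [Finset.prod_congr rfl (fun c _ => e2 c), Finset.prod_mul_distrib, Finset.prod_const,
    Finset.prod_ite, Finset.prod_const, Finset.prod_const_one, mul_one, ← hJc]
  simp [numComponents]

/-- `(2x−1)^n · B(G;1/(2x−1),1/(2x−1),z) = ∑_{F⊆E, (V,F) bipartite} 2^{k(V,F)} x^{iso(V,F)} z^{|F|}`,
whose coefficient of `x^i z^j` counts the bicolored subgraphs of `G` with exactly `i`
isolated vertices and exactly `j` edges. -/
theorem bipartitionPoly_bicolored_subgraphs {V : Type*} [Fintype V] (G : SimpleGraph V)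
    (x z : ℝ) (hx : 2 * x - 1 ≠ 0) :
    (2 * x - 1) ^ Fintype.card V *
        bipartitionPoly G (1 / (2 * x - 1)) (1 / (2 * x - 1)) z =
      ∑ F ∈ G.edgeFinset.powerset.filter
          (fun F : Finset (Sym2 V) =>
            (SimpleGraph.fromEdgeSet (↑F : Set (Sym2 V))).Colorable 2),
        2 ^ numComponents (SimpleGraph.fromEdgeSet (↑F : Set (Sym2 V))) *
          x ^ isoCount F * z ^ F.card := by
  have hL : (2 * x - 1) ^ Fintype.card V *
        bipartitionPoly G (1 / (2 * x - 1)) (1 / (2 * x - 1)) z =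
      ∑ W : Finset V, ∑ F ∈ G.edgeFinset.powerset,
        if F ⊆ edgeBoundary G W then
          (2 * x - 1) ^ ((Finset.univ.filter fun v : V => ∀ e ∈ F, v ∉ e) \ W).card * z ^ F.card
        else 0 := by
    unfold bipartitionPoly
    rw [Finset.mul_sum]
    refine Finset.sum_congr rfl fun W _ => ?_
    rw [← Finset.sum_filter]
    have : G.edgeFinset.powerset.filter (fun F => F ⊆ edgeBoundary G W) =
        (edgeBoundary G W).powerset := by
      ext F
      simp only [Finset.mem_filter, Finset.mem_powerset]
      exact ⟨fun h => h.2, fun h => ⟨h.trans (Finset.filter_subset _ _), h⟩⟩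
    rw [this, Finset.mul_sum, Finset.mul_sum]
    refine Finset.sum_congr rfl fun F _ => ?_
    have hcard : Fintype.card V = W.card + (extNbr F W).card +
        ((Finset.univ.filter fun v : V => ∀ e ∈ F, v ∉ e) \ W).card := by
      rw [← Finset.card_univ, ← Finset.card_union_of_disjoint, ← Finset.card_union_of_disjoint]
      · congr 1
        ext v
        simp only [extNbr, Finset.mem_union, Finset.mem_filter, Finset.mem_univ, true_and,
          Finset.mem_sdiff, true_iff]
        by_cases hv : v ∈ W
        · simp [hv]
        · by_cases h : ∃ e ∈ F, v ∈ e
          · simp [hv, h]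
          · right
            push Not at h
            exact ⟨h, hv⟩
      · rw [Finset.disjoint_left]
        intro v hv
        simp only [extNbr, Finset.mem_union, Finset.mem_filter, Finset.mem_univ, true_and,
          Finset.mem_sdiff] at hv ⊢
        rintro ⟨h1, h2⟩
        rcases hv with hv | ⟨-, e, he, hve⟩
        · exact h2 hv
        · exact h1 e he hve
      · rw [Finset.disjoint_left]
        intro v hv
        simp [extNbr, hv]
    rw [hcard, pow_add, pow_add, one_div, inv_pow, inv_pow]
    field_simp
  rw [hL, Finset.sum_comm, Finset.sum_filter]
  refine Finset.sum_congr rfl fun F hF => ?_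
  rw [Finset.mem_powerset] at hF
  simp_rw [subset_edgeBoundary_iff G F hF]
  rw [← Finset.sum_filter, ← Finset.sum_mul]
  split_ifs with hc
  · rw [sum_goodSet _ _ _ x hc]
    · rfl
    · intro v
      simp only [Finset.mem_filter, Finset.mem_univ, true_and, SimpleGraph.fromEdgeSet_adj]
      constructor
      · intro h u hu
        exact h _ (Finset.mem_coe.1 hu.1) (Sym2.mem_mk_left v u)
      · intro h e he hv
        obtain ⟨u, rfl⟩ := hv
        have hadj : G.Adj v u := by simpa using hF he
        exact h u ⟨Finset.mem_coe.2 he, hadj.ne⟩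
  · rw [← exists_goodSet_iff] at hc
    rw [Finset.filter_false_of_mem (fun W _ hW => hc ⟨W, hW⟩)]
    simp
end

section
/- For every finite simple graph G = (V,E) of order n, the number of bicolored subgraphs of G without isolated vertices equals (−1)^n · B(G;−1,−1,1); explicitly, (−1)^n · B(G;−1,−1,1) = ∑ 2^{k(V,F)}, where the sum is over all F ⊆ E such that (V,F) is bipartite and has no isolated vertices. -/
open Finset

open scoped Classical

theorem aux_count {V : Type*} [Fintype V] (H : SimpleGraph V) :
    (Finset.univ.filter fun W : Finset V => ∀ u v, H.Adj u v → (u ∈ W ↔ v ∉ W)).card =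
      if H.Colorable 2 then 2 ^ numComponents H else 0 := by
  split_ifs with h
  · obtain ⟨c⟩ := h
    have hc : ∀ u v, H.Adj u v → (c u = 0 ↔ ¬ c v = 0) := by
      intro u v huv
      have := c.valid huv
      omega
    have : (2 : ℕ) ^ numComponents H = Fintype.card (Finset H.ConnectedComponent) := by
      rw [Fintype.card_finset, numComponents]
    rw [this, ← Finset.card_univ]
    symm
    refine Finset.card_bij
      (fun S _ => Finset.univ.filter fun v => (c v = 0 ↔ H.connectedComponentMk v ∈ S)) ?_ ?_ ?_
    · intro S _
      simp only [Finset.mem_filter, Finset.mem_univ, true_and]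
      intro u v huv
      have h1 := hc u v huv
      have h2 : H.connectedComponentMk u = H.connectedComponentMk v :=
        SimpleGraph.ConnectedComponent.sound huv.reachable
      rw [h2]
      tauto
    · intro S _ T _ hST
      ext C
      induction C using SimpleGraph.ConnectedComponent.ind with
      | _ v =>
        have := Finset.ext_iff.1 hST v
        simp only [Finset.mem_filter, Finset.mem_univ, true_and] at this
        tauto
    · intro W hW
      simp only [Finset.mem_filter, Finset.mem_univ, true_and] at hW
      have key : ∀ u v, H.Reachable u v → ((c u = 0 ↔ u ∈ W) ↔ (c v = 0 ↔ v ∈ W)) := by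
        rintro u v ⟨p⟩
        induction p with
        | nil => rfl
        | cons hadj _ ih =>
          have h1 := hc _ _ hadj
          have h2 := hW _ _ hadj
          rw [← ih]
          tauto
      refine ⟨Finset.univ.filter fun C => ∃ u, H.connectedComponentMk u = C ∧ (c u = 0 ↔ u ∈ W),
        Finset.mem_univ _, ?_⟩
      ext v
      simp only [Finset.mem_filter, Finset.mem_univ, true_and]
      have : (∃ u, H.connectedComponentMk u = H.connectedComponentMk v ∧ (c u = 0 ↔ u ∈ W)) ↔
          (c v = 0 ↔ v ∈ W) := by
        constructor
        · rintro ⟨u, hu, h⟩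
          exact (key u v (SimpleGraph.ConnectedComponent.exact hu)).1 h
        · intro h
          exact ⟨v, rfl, h⟩
      rw [this]
      tauto
  · rw [Finset.card_eq_zero, Finset.filter_eq_empty_iff]
    intro W _ hW
    apply h
    refine ⟨SimpleGraph.Coloring.mk (fun v => if v ∈ W then 0 else 1) ?_⟩
    intro u v huv
    have := hW u v huv
    by_cases hu : u ∈ W <;> by_cases hv : v ∈ W <;> simp_all

theorem aux_subset {V : Type*} [Fintype V] (G : SimpleGraph V) (F : Finset (Sym2 V))
    (W : Finset V) : F ∈ (edgeBoundary G W).powerset ↔ F ∈ G.edgeFinset.powerset ∧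
      ∀ u v, (SimpleGraph.fromEdgeSet (↑F : Set (Sym2 V))).Adj u v → (u ∈ W ↔ v ∉ W) := by
  simp only [Finset.mem_powerset, SimpleGraph.fromEdgeSet_adj, Finset.mem_coe]
  constructor
  · intro h
    refine ⟨fun e he => (Finset.mem_filter.1 (h he)).1, ?_⟩
    rintro u v ⟨huv, -⟩
    obtain ⟨a, ha, b, hb, hab⟩ := (Finset.mem_filter.1 (h huv)).2
    rcases Sym2.eq_iff.1 hab with ⟨rfl, rfl⟩ | ⟨rfl, rfl⟩ <;> tauto
  · rintro ⟨h1, h2⟩ e he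
    refine Finset.mem_filter.2 ⟨h1 he, ?_⟩
    induction e using Sym2.ind with
    | _ u v =>
      have hadj : G.Adj u v := by simpa using h1 he
      have := h2 u v ⟨he, hadj.ne⟩
      by_cases hu : u ∈ W
      · exact ⟨u, hu, v, this.1 hu, rfl⟩
      · exact ⟨v, by tauto, u, hu, Sym2.eq_swap⟩

theorem aux_sign {V : Type*} [Fintype V] (F : Finset (Sym2 V)) (W : Finset V) :
    (-1 : ℤ) ^ Fintype.card V * ((-1) ^ W.card * (-1) ^ (extNbr F W).card) =
      ∏ v : V, if v ∉ W ∧ ¬ ∃ e ∈ F, v ∈ e then (-1 : ℤ) else 1 := by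
  have h1 : (-1 : ℤ) ^ Fintype.card V = ∏ _v : V, (-1 : ℤ) := by simp
  have h2 : (-1 : ℤ) ^ W.card = ∏ v : V, if v ∈ W then (-1 : ℤ) else 1 := by
    simp [Finset.prod_ite]
  have h3 : (-1 : ℤ) ^ (extNbr F W).card =
      ∏ v : V, if v ∉ W ∧ ∃ e ∈ F, v ∈ e then (-1 : ℤ) else 1 := by
    rw [Finset.prod_ite]
    simp [extNbr]
  rw [h1, h2, h3, ← Finset.prod_mul_distrib, ← Finset.prod_mul_distrib]
  refine Finset.prod_congr rfl fun v _ => ?_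
  by_cases a : v ∈ W <;> by_cases b : ∃ e ∈ F, v ∈ e <;> simp only [a, b] <;> simp

theorem aux_zero {V : Type*} [Fintype V] (F : Finset (Sym2 V)) (v : V)
    (hv : ¬ ∃ e ∈ F, v ∈ e) :
    ∑ W ∈ Finset.univ.filter (fun W : Finset V => ∀ a b,
      (SimpleGraph.fromEdgeSet (↑F : Set (Sym2 V))).Adj a b → (a ∈ W ↔ b ∉ W)),
      (∏ w : V, if w ∉ W ∧ ¬ ∃ e ∈ F, w ∈ e then (-1 : ℤ) else 1) = 0 := by
  have hm : ∀ W : Finset V, ∀ a, a ∈ symmDiff W {v} ↔ (a ∈ W ↔ a ≠ v) := by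
    intro W a
    simp only [Finset.mem_symmDiff, Finset.mem_singleton]
    tauto
  have hs : ∀ W : Finset V,
      (∏ w : V, if w ∉ W ∧ ¬ ∃ e ∈ F, w ∈ e then (-1 : ℤ) else 1) +
      (∏ w : V, if w ∉ symmDiff W {v} ∧ ¬ ∃ e ∈ F, w ∈ e then (-1 : ℤ) else 1) = 0 := by
    intro W
    rw [← Finset.mul_prod_erase _ _ (Finset.mem_univ v),
      ← Finset.mul_prod_erase (a := v) _ (fun w => if w ∉ symmDiff W {v} ∧ _ then (-1 : ℤ) else 1)
        (Finset.mem_univ v)]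
    have : ∀ w ∈ Finset.univ.erase v,
        (if w ∉ symmDiff W {v} ∧ ¬ ∃ e ∈ F, w ∈ e then (-1 : ℤ) else 1) =
        if w ∉ W ∧ ¬ ∃ e ∈ F, w ∈ e then (-1 : ℤ) else 1 := by
      intro w hw
      have : w ≠ v := Finset.ne_of_mem_erase hw
      simp only [hm, this, ne_eq, not_false_eq_true, iff_true]
    rw [Finset.prod_congr rfl this, ← add_mul]
    convert zero_mul _
    simp only [hm]
    by_cases a : v ∈ W <;> simp only [a, hv] <;> simp
  refine Finset.sum_involution (fun W _ => symmDiff W {v}) (fun W _ => hs W) ?_ ?_ ?_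
  · intro W _ _ h
    have := hm W v
    rw [h] at this
    tauto
  · intro W hW
    simp only [Finset.mem_filter, Finset.mem_univ, true_and] at hW ⊢
    intro a b hab
    have hab' := hab
    rw [SimpleGraph.fromEdgeSet_adj] at hab'
    have ha : a ≠ v := fun h => hv ⟨_, hab'.1, by simp [h]⟩
    have hb : b ≠ v := fun h => hv ⟨_, hab'.1, by simp [h]⟩
    have := hW a b hab
    rw [hm, hm]
    tauto
  · intro W _
    simp

/-- The number of bicolored subgraphs of `G` without isolated vertices equals
`(−1)^n · B(G;−1,−1,1) = ∑_{F⊆E, (V,F) bipartite without isolated vertices} 2^{k(V,F)}`. -/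
theorem bipartitionPoly_bicolored_no_isolated {V : Type*} [Fintype V]
    (G : SimpleGraph V) :
    (-1 : ℤ) ^ Fintype.card V * bipartitionPoly G (-1 : ℤ) (-1) 1 =
      ∑ F ∈ G.edgeFinset.powerset.filter
          (fun F : Finset (Sym2 V) =>
            (SimpleGraph.fromEdgeSet (↑F : Set (Sym2 V))).Colorable 2 ∧
              ∀ v : V, ∃ e ∈ F, v ∈ e),
        2 ^ numComponents (SimpleGraph.fromEdgeSet (↑F : Set (Sym2 V))) := by
  unfold bipartitionPoly
  simp only [one_pow, mul_one, Finset.mul_sum]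
  rw [Finset.sum_comm' (t' := G.edgeFinset.powerset)
    (s' := fun F => Finset.univ.filter (fun W : Finset V => ∀ a b,
      (SimpleGraph.fromEdgeSet (↑F : Set (Sym2 V))).Adj a b → (a ∈ W ↔ b ∉ W)))
    (h := by
      intro W F
      rw [aux_subset]
      simp only [Finset.mem_filter, Finset.mem_univ, true_and]
      tauto), Finset.sum_filter]
  refine Finset.sum_congr rfl fun F _ => ?_
  simp only [aux_sign]
  by_cases hF : ∀ v : V, ∃ e ∈ F, v ∈ e
  · simp only [hF, not_true_eq_false, and_false, if_false, Finset.prod_const_one,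
      Finset.sum_const]
    have h := aux_count (SimpleGraph.fromEdgeSet (↑F : Set (Sym2 V)))
    rw [nsmul_eq_mul, mul_one]
    simp only [implies_true, and_true]
    trans (((if (SimpleGraph.fromEdgeSet (↑F : Set (Sym2 V))).Colorable 2 then
      2 ^ numComponents (SimpleGraph.fromEdgeSet (↑F : Set (Sym2 V))) else 0 : ℕ)) : ℤ)
    · rw [← h]
      congr!
    · split_ifs <;> simp
  · rw [if_neg (fun h => hF h.2)]
    obtain ⟨v, hv⟩ := not_forall.1 hF
    exact aux_zero F v hv
end
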